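/- arXiv:1601.05299 — 12 statements merged into one kernel-verified Lean document; each statement's English description precedes it below -/
import Mathlib

section
/- (Proposition B.1(i)) For every n ∈ ℕ, the function α ↦ Re(θ_n(α)) is strictly increasing on (0,∞); moreover Re(θ_n(α)) → nν as α → 0⁺ and Re(θ_n(α)) → (n+1)ν as α → +∞. -/
open Filter Topology in
/-- Bounded solutions of the dispersion relation have `exp (2 * I * ℓ * θ) → 1` as `α → ∞`. -/
theorem tendsto_exp_of_dispersion {ℓ B : ℝ} {θ : ℝ → ℂ}
    (heq : ∀ α : ℝ, 0 ≤ α →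
      ((α : ℂ) - θ α) ^ 2 * Complex.exp (2 * Complex.I * (ℓ : ℂ) * θ α) = ((α : ℂ) + θ α) ^ 2)
    (hB : ∀ α : ℝ, 0 < α → ‖θ α‖ ≤ B) :
    Tendsto (fun α => Complex.exp (2 * Complex.I * (ℓ : ℂ) * θ α)) atTop (𝓝 1) := by
  have hq : Tendsto (fun α : ℝ => θ α / (α : ℂ)) atTop (𝓝 0) := by
    refine squeeze_zero_norm' ?_ ((tendsto_const_nhds (x := B)).div_atTop tendsto_id)
    filter_upwards [eventually_gt_atTop 0] with α hα
    rw [norm_div, Complex.norm_real, Real.norm_of_nonneg hα.le]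
    exact div_le_div_of_nonneg_right (hB α hα) hα.le
  have hlim : Tendsto (fun α : ℝ => (1 + θ α / (α : ℂ)) ^ 2 / (1 - θ α / (α : ℂ)) ^ 2)
      atTop (𝓝 1) := by
    simpa [Pi.div_def] using
      ((hq.const_add 1).pow 2).div ((hq.const_sub 1).pow 2) (by simp)
  refine hlim.congr' ?_
  filter_upwards [eventually_gt_atTop 0, eventually_gt_atTop B] with α hα hαB
  have hα' : (α : ℂ) ≠ 0 := by exact_mod_cast hα.ne'
  have hne : (α : ℂ) - θ α ≠ 0 := by
    intro h
    have h' := hB α hα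
    rw [← sub_eq_zero.1 h, Complex.norm_real, Real.norm_of_nonneg hα.le] at h'
    linarith
  have e₁ : 1 + θ α / (α : ℂ) = (α + θ α) / α := by field_simp
  have e₂ : 1 - θ α / (α : ℂ) = (α - θ α) / α := by field_simp
  rw [e₁, e₂, div_pow, div_pow, div_div_div_cancel_right₀ (pow_ne_zero 2 hα'), ← heq α hα.le,
    mul_div_cancel_left₀ _ (pow_ne_zero 2 hne)]

/-- Implicit differentiation of the dispersion relation. -/
theorem deriv_mul_of_dispersion {ℓ α : ℝ} {θ : ℝ → ℂ} {θ' : ℂ} (hα : 0 < α)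
    (hθ : HasDerivAt θ θ' α)
    (heq : ∀ α : ℝ, 0 ≤ α →
      ((α : ℂ) - θ α) ^ 2 * Complex.exp (2 * Complex.I * (ℓ : ℂ) * θ α) = ((α : ℂ) + θ α) ^ 2)
    (hne : (α : ℂ) + θ α ≠ 0) :
    θ' * (2 * α - Complex.I * ℓ * (α ^ 2 - θ α ^ 2)) = 2 * θ α := by
  have hid : HasDerivAt (fun a : ℝ => (a : ℂ)) 1 α := Complex.ofRealCLM.hasDerivAt
  have hl := ((hid.sub hθ).pow 2).mul (hθ.const_mul (2 * Complex.I * (ℓ : ℂ))).cexp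
  have hr := (hid.add hθ).pow 2
  have hlr := hl.congr_of_eventuallyEq (f₁ := ((fun a : ℝ => (a : ℂ)) + θ) ^ 2) (by
    filter_upwards [lt_mem_nhds hα] with a ha
    simpa using (heq a ha.le).symm)
  have key := hlr.unique hr
  simp only [Pi.sub_apply, Pi.add_apply, Pi.pow_apply] at key
  have h := heq α hα.le
  push_cast at key
  simp only [pow_one] at key
  generalize Complex.exp (2 * Complex.I * (ℓ : ℂ) * θ α) = E at key h
  apply mul_left_cancel₀ hne
  generalize θ α = t at *
  linear_combination (-(α - t) / 2) * key + (1 - θ' + Complex.I * ℓ * θ' * (α - t)) * h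

/-- In the lower right quadrant the real part of `θ` increases along the dispersion relation. -/
theorem re_pos_of_deriv_mul {ℓ α : ℝ} {t t' : ℂ} (hℓ : 0 < ℓ) (hα : 0 < α)
    (hre : 0 < t.re) (him : t.im < 0)
    (h : t' * (2 * α - Complex.I * ℓ * (α ^ 2 - t ^ 2)) = 2 * t) : 0 < t'.re := by
  obtain ⟨x, y⟩ := t
  obtain ⟨p, q⟩ := t'
  simp only at hre him ⊢
  have h1 := congrArg Complex.re h
  have h2 := congrArg Complex.im h
  simp [pow_two] at h1 h2
  have hD : 0 < (2 * α - 2 * ℓ * x * y) ^ 2 + (ℓ * (α ^ 2 - x ^ 2 + y ^ 2)) ^ 2 := by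
    have : 0 < 2 * α - 2 * ℓ * x * y := by
      have := mul_pos (mul_pos hℓ hre) (neg_pos.2 him)
      linarith
    positivity
  have hN : 0 < 2 * (2 * α * x + ℓ * (-y) * (x ^ 2 + α ^ 2 + y ^ 2)) := by
    have := neg_pos.2 him
    positivity
  rw [← mul_pos_iff_of_pos_right hD]
  refine hN.trans_eq ?_
  linear_combination -(2 * α - 2 * ℓ * x * y) * h1 + (ℓ * (α ^ 2 - x ^ 2 + y ^ 2)) * h2


theorem stmt_1 (ℓ : ℝ) (hℓ : 0 < ℓ) (ν : ℝ) (hν : ν = Real.pi / ℓ)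
    (θ : ℕ → ℝ → ℂ)
    (hcont : ∀ n : ℕ, ContinuousOn (θ n) (Set.Ici 0))
    (hdiff : ∀ n : ℕ, ∀ α : ℝ, 0 < α → DifferentiableAt ℝ (θ n) α)
    (h0 : ∀ n : ℕ, θ n 0 = ((n * ν : ℝ) : ℂ))
    (heq : ∀ n : ℕ, ∀ α : ℝ, 0 ≤ α →
      ((α : ℂ) - θ n α) ^ 2 * Complex.exp (2 * Complex.I * (ℓ : ℂ) * θ n α)
        = ((α : ℂ) + θ n α) ^ 2)
    (hre : ∀ n : ℕ, ∀ α : ℝ, 0 < α →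
      (θ n α).re ∈ Set.Ioo ((n : ℝ) * ν) (((n : ℝ) + 1) * ν))
    (him : ∀ n : ℕ, ∀ α : ℝ, 0 < α → (θ n α).im < 0)
    (hbd : ∀ n : ℕ, ∃ C : ℝ, 0 < C ∧ ∀ α : ℝ, 0 < α → -C ≤ (θ n α).im) :
    ∀ n : ℕ,
      StrictMonoOn (fun α : ℝ => (θ n α).re) (Set.Ioi 0) ∧
      Filter.Tendsto (fun α : ℝ => (θ n α).re) (nhdsWithin 0 (Set.Ioi 0))
        (nhds ((n : ℝ) * ν)) ∧
      Filter.Tendsto (fun α : ℝ => (θ n α).re) Filter.atTop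
        (nhds (((n : ℝ) + 1) * ν)) := by

  intro n
  have hνpos : 0 < ν := hν ▸ div_pos Real.pi_pos hℓ
  have hnν : 0 ≤ (n : ℝ) * ν := by positivity
  have hrepos : ∀ α : ℝ, 0 < α → 0 < (θ n α).re := fun α hα => hnν.trans_lt (hre n α hα).1
  have hmono : StrictMonoOn (fun α : ℝ => (θ n α).re) (Set.Ioi 0) := by
    have hder : ∀ α : ℝ, 0 < α →
        HasDerivAt (fun α : ℝ => (θ n α).re) (deriv (θ n) α).re α := fun α hα =>
      Complex.reCLM.hasFDerivAt.comp_hasDerivAt α (hdiff n α hα).hasDerivAt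
    refine strictMonoOn_of_deriv_pos (convex_Ioi 0)
      (fun α hα => (hder α hα).continuousAt.continuousWithinAt) fun α hα => ?_
    rw [interior_Ioi, Set.mem_Ioi] at hα
    rw [(hder α hα).deriv]
    refine re_pos_of_deriv_mul hℓ hα (hrepos α hα) (him n α hα)
      (deriv_mul_of_dispersion hα (hdiff n α hα).hasDerivAt (heq n) fun h => ?_)
    have := congrArg Complex.re h
    simp only [Complex.add_re, Complex.ofReal_re, Complex.zero_re] at this
    linarith [hrepos α hα]
  refine ⟨hmono, ?_, ?_⟩
  · have h := (hcont n 0 Set.self_mem_Ici).mono Set.Ioi_subset_Ici_self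
    have h' := (Complex.continuous_re.tendsto _).comp h.tendsto
    rwa [h0, Complex.ofReal_re] at h'
  · obtain ⟨C, -, hC⟩ := hbd n
    have hexp := tendsto_exp_of_dispersion (heq n) (B := ((n : ℝ) + 1) * ν + C) fun α hα => by
      refine (Complex.norm_le_abs_re_add_abs_im _).trans ?_
      rw [abs_of_pos (hrepos α hα), abs_of_neg (him n α hα)]
      linarith [(hre n α hα).2, hC α hα]
    have hcos : Filter.Tendsto (fun α : ℝ => Real.cos (2 * ℓ * (θ n α).re)) Filter.atTop
        (nhds 1) := by
      have h := ((Complex.continuous_re.tendsto _).comp hexp).div hexp.norm (by simp)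
      simp only [Complex.one_re, norm_one, div_one] at h
      refine h.congr fun α => ?_
      simp [Complex.exp_re, Complex.norm_exp]
    obtain ⟨L, hL⟩ : ∃ L, Filter.Tendsto (fun α : ℝ => (θ n α).re) Filter.atTop (nhds L) := by
      have hm : Monotone fun α : ℝ => (θ n (max α 1)).re := fun a b hab =>
        hmono.monotoneOn (Set.mem_Ioi.2 (lt_max_of_lt_right one_pos))
          (Set.mem_Ioi.2 (lt_max_of_lt_right one_pos))
          (max_le_max_right 1 hab)
      have hb : BddAbove (Set.range fun α : ℝ => (θ n (max α 1)).re) := by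
        refine ⟨((n : ℝ) + 1) * ν, ?_⟩
        rintro _ ⟨α, rfl⟩
        exact (hre n _ (lt_max_of_lt_right one_pos)).2.le
      refine ⟨_, (tendsto_atTop_ciSup hm hb).congr' ?_⟩
      filter_upwards [Filter.eventually_ge_atTop 1] with α hα
      rw [max_eq_left hα]
    have hLle : L ≤ ((n : ℝ) + 1) * ν := le_of_tendsto hL <| by
      filter_upwards [Filter.eventually_gt_atTop 0] with α hα using (hre n α hα).2.le
    have hLgt : (n : ℝ) * ν < L := (hre n 1 one_pos).1.trans_le <| ge_of_tendsto hL <| by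
      filter_upwards [Filter.eventually_ge_atTop 1] with α hα using
        hmono.monotoneOn (Set.mem_Ioi.2 one_pos) (Set.mem_Ioi.2 (one_pos.trans_le hα)) hα
    obtain ⟨k, hk⟩ := (Real.cos_eq_one_iff _).1 <| tendsto_nhds_unique
      ((Real.continuous_cos.tendsto _).comp (hL.const_mul (2 * ℓ))) hcos
    have hLk : L = k * ν := by
      rw [hν]
      field_simp
      linarith
    rw [hLk] at hLgt hLle
    have h1 : (n : ℤ) < k := by exact_mod_cast lt_of_mul_lt_mul_right hLgt hνpos.le
    have h2 : k ≤ (n : ℤ) + 1 := by exact_mod_cast le_of_mul_le_mul_right hLle hνpos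
    have h3 : (k : ℝ) = n + 1 := by exact_mod_cast le_antisymm h2 h1
    rwa [hLk, h3] at hL
end

section
/- (Proposition B.1(ii)) For every n ∈ ℕ, Im(θ_n(α)) → 0 as α → +∞. -/
/-- Any solution with `Re z ≤ X` and `Im z < 0` has `-Im z ≤ 8 X / (ℓ α)` as soon as `α ≥ 2 X`. -/
lemma neg_im_le_of_dispersion {ℓ α X : ℝ} {z : ℂ} (hℓ : 0 < ℓ) (hα : 0 < α)
    (hreX : z.re ≤ X) (hX : 2 * X ≤ α) (him : z.im < 0)
    (heq : ((α : ℂ) - z) ^ 2 * Complex.exp (2 * Complex.I * (ℓ : ℂ) * z) = ((α : ℂ) + z) ^ 2) :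
    -z.im ≤ 8 * X / ℓ / α := by
  have hnorm : ((α - z.re) ^ 2 + z.im ^ 2) * Real.exp (-(2 * ℓ * z.im))
      = (α + z.re) ^ 2 + z.im ^ 2 := by
    have h := congrArg norm heq
    rw [norm_mul, norm_pow, norm_pow, Complex.norm_exp, Complex.sq_norm, Complex.sq_norm,
      Complex.normSq_apply, Complex.normSq_apply] at h
    simp at h
    linear_combination h
  have hexp := Real.add_one_le_exp (-(2 * ℓ * z.im))
  have ht : 0 < -(2 * ℓ * z.im) := by nlinarith
  have hsq : α ^ 2 / 4 ≤ (α - z.re) ^ 2 + z.im ^ 2 := by nlinarith [sq_nonneg z.im]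
  have hlin : -(2 * ℓ * z.im) * (α ^ 2 / 4) ≤ 4 * α * z.re := by
    have h₁ := mul_le_mul_of_nonneg_left hexp ((by positivity : 0 ≤ α ^ 2 / 4).trans hsq)
    have h₂ := mul_le_mul_of_nonneg_left hsq ht.le
    linarith
  have hcancel : -(2 * ℓ * z.im) * α ≤ 16 * z.re := by
    refine le_of_mul_le_mul_left ?_ hα
    linarith
  rw [le_div_iff₀ hα, le_div_iff₀ hℓ]
  linarith

theorem stmt_2 (ℓ : ℝ) (hℓ : 0 < ℓ) (ν : ℝ) (hν : ν = Real.pi / ℓ)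
    (θ : ℕ → ℝ → ℂ)
    (hcont : ∀ n : ℕ, ContinuousOn (θ n) (Set.Ici 0))
    (hdiff : ∀ n : ℕ, ∀ α : ℝ, 0 < α → DifferentiableAt ℝ (θ n) α)
    (h0 : ∀ n : ℕ, θ n 0 = ((n * ν : ℝ) : ℂ))
    (heq : ∀ n : ℕ, ∀ α : ℝ, 0 ≤ α →
      ((α : ℂ) - θ n α) ^ 2 * Complex.exp (2 * Complex.I * (ℓ : ℂ) * θ n α)
        = ((α : ℂ) + θ n α) ^ 2)
    (hre : ∀ n : ℕ, ∀ α : ℝ, 0 < α →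
      (θ n α).re ∈ Set.Ioo ((n : ℝ) * ν) (((n : ℝ) + 1) * ν))
    (him : ∀ n : ℕ, ∀ α : ℝ, 0 < α → (θ n α).im < 0)
    (hbd : ∀ n : ℕ, ∃ C : ℝ, 0 < C ∧ ∀ α : ℝ, 0 < α → -C ≤ (θ n α).im) :
    ∀ n : ℕ,
      Filter.Tendsto (fun α : ℝ => (θ n α).im) Filter.atTop (nhds 0) := by
  intro n
  have hlim : Filter.Tendsto (fun α : ℝ => -(8 * (((n : ℝ) + 1) * ν) / ℓ / α))
      Filter.atTop (nhds 0) := by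
    simpa using (Filter.tendsto_id.const_div_atTop (8 * (((n : ℝ) + 1) * ν) / ℓ)).neg
  refine tendsto_of_tendsto_of_tendsto_of_le_of_le' hlim tendsto_const_nhds ?_ ?_
  · filter_upwards [Filter.eventually_gt_atTop 0,
      Filter.eventually_ge_atTop (2 * (((n : ℝ) + 1) * ν))] with α hα hX
    have hhi := (hre n α hα).2
    exact neg_le.mp
      (neg_im_le_of_dispersion hℓ hα hhi.le hX (him n α hα) (heq n α hα.le))
  · filter_upwards [Filter.eventually_gt_atTop 0] with α hα
    exact (him n α hα).le
end

section
/- (Proposition B.1(iii)) There exists a constant C ≥ 0 such that for every integer n ≥ 2 and every α ≥ 0 one has |Im(θ_n(α))| ≤ C·ln(n); in other words, sup_{α≥0} |Im(θ_n(α))| = O(ln n) as n → ∞. -/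
/-- Taking moduli in the dispersion relation `(α - z)² e^{2iℓz} = (α + z)²`. -/
theorem exp_mul_sq_eq_of_dispersion {ℓ α : ℝ} {z : ℂ}
    (h : ((α : ℂ) - z) ^ 2 * Complex.exp (2 * Complex.I * (ℓ : ℂ) * z) = ((α : ℂ) + z) ^ 2) :
    ((α - z.re) ^ 2 + z.im ^ 2) * Real.exp (2 * ℓ * -z.im) = (α + z.re) ^ 2 + z.im ^ 2 := by
  have h' := congrArg norm h
  rw [norm_mul, norm_pow, norm_pow, Complex.norm_exp, Complex.sq_norm, Complex.sq_norm,
    Complex.normSq_apply, Complex.normSq_apply] at h'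
  have hre : (2 * Complex.I * (ℓ : ℂ) * z).re = 2 * ℓ * -z.im := by simp
  rw [hre] at h'
  simp only [Complex.sub_re, Complex.sub_im, Complex.add_re, Complex.add_im, Complex.ofReal_re,
    Complex.ofReal_im] at h'
  linear_combination h'

/-- A solution of the modulus equation has at most polynomial exponential growth in `x`. -/
theorem exp_le_of_modulus_eq {ℓ α x y N : ℝ} (hℓ : 0 < ℓ) (hy : 0 < y) (hα : 0 ≤ α)
    (hx : 0 ≤ x) (hN : 1 ≤ N) (hxN : ℓ * x ≤ N * Real.pi)
    (h : ((α - x) ^ 2 + y ^ 2) * Real.exp (2 * ℓ * y) = (α + x) ^ 2 + y ^ 2) :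
    Real.exp (2 * ℓ * y) ≤ 100 * N ^ 2 := by
  have hN2 : 1 ≤ N ^ 2 := one_le_pow₀ hN
  have hE : 1 ≤ Real.exp (2 * ℓ * y) := Real.one_le_exp (by positivity)
  set E := Real.exp (2 * ℓ * y) with hEdef
  rcases le_total (2 * x) α with hc | hc
  · have h9 : E ≤ 9 := by
      have hpos : 0 < (α - x) ^ 2 + y ^ 2 := by positivity
      refine le_of_mul_le_mul_left ?_ hpos
      rw [h]
      nlinarith [sq_nonneg y, mul_nonneg (sub_nonneg.2 hc) (by linarith : 0 ≤ 2 * α - x)]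
    linarith
  · rcases le_total (ℓ * y) 1 with hs | hs
    · have h9 : E ≤ 9 := by
        calc E ≤ Real.exp (1 + 1) := Real.exp_le_exp.2 (by linarith)
          _ = Real.exp 1 * Real.exp 1 := Real.exp_add _ _
          _ ≤ 3 * 3 := by
            have := Real.exp_one_lt_three.le
            gcongr
          _ = 9 := by norm_num
      linarith
    · have hmain : y ^ 2 * (E - 1) ≤ 9 * x ^ 2 := by
        nlinarith [mul_nonneg (sq_nonneg (α - x)) (by linarith : 0 ≤ E),
          mul_nonneg (sub_nonneg.2 hc) (by linarith : 0 ≤ α + 4 * x)]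
      have hscaled : (ℓ * y) ^ 2 * (E - 1) ≤ 9 * (ℓ * x) ^ 2 := by
        nlinarith [mul_le_mul_of_nonneg_left hmain (sq_nonneg ℓ)]
      have hlow : E - 1 ≤ (ℓ * y) ^ 2 * (E - 1) :=
        le_mul_of_one_le_left (by linarith) (one_le_pow₀ hs)
      have hπ : Real.pi ^ 2 ≤ 10 := by nlinarith [Real.pi_lt_d2, Real.pi_pos]
      have hsq : (ℓ * x) ^ 2 ≤ N ^ 2 * 10 := by
        calc (ℓ * x) ^ 2 ≤ (N * Real.pi) ^ 2 := by gcongr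
          _ = N ^ 2 * Real.pi ^ 2 := mul_pow _ _ _
          _ ≤ N ^ 2 * 10 := by gcongr
      linarith


theorem stmt_3 (ℓ : ℝ) (hℓ : 0 < ℓ) (ν : ℝ) (hν : ν = Real.pi / ℓ)
    (θ : ℕ → ℝ → ℂ)
    (hcont : ∀ n : ℕ, ContinuousOn (θ n) (Set.Ici 0))
    (hdiff : ∀ n : ℕ, ∀ α : ℝ, 0 < α → DifferentiableAt ℝ (θ n) α)
    (h0 : ∀ n : ℕ, θ n 0 = ((n * ν : ℝ) : ℂ))
    (heq : ∀ n : ℕ, ∀ α : ℝ, 0 ≤ α →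
      ((α : ℂ) - θ n α) ^ 2 * Complex.exp (2 * Complex.I * (ℓ : ℂ) * θ n α)
        = ((α : ℂ) + θ n α) ^ 2)
    (hre : ∀ n : ℕ, ∀ α : ℝ, 0 < α →
      (θ n α).re ∈ Set.Ioo ((n : ℝ) * ν) (((n : ℝ) + 1) * ν))
    (him : ∀ n : ℕ, ∀ α : ℝ, 0 < α → (θ n α).im < 0)
    (hbd : ∀ n : ℕ, ∃ C : ℝ, 0 < C ∧ ∀ α : ℝ, 0 < α → -C ≤ (θ n α).im) :
    ∃ C : ℝ, 0 ≤ C ∧ ∀ n : ℕ, 2 ≤ n → ∀ α : ℝ, 0 ≤ α →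
      |(θ n α).im| ≤ C * Real.log n := by
  refine ⟨5 / ℓ, by positivity, fun n hn α hα => ?_⟩
  have hn' : (2 : ℝ) ≤ n := by exact_mod_cast hn
  have hlog : 0 ≤ Real.log n := Real.log_nonneg (by linarith)
  rcases hα.eq_or_lt with rfl | hα'
  · rw [h0, Complex.ofReal_im, abs_zero]
    positivity
  have hy := him n α hα'
  obtain ⟨hlo, hhi⟩ := hre n α hα'
  have hνpos : 0 < ν := hν ▸ div_pos Real.pi_pos hℓ
  have hℓν : ℓ * ν = Real.pi := by rw [hν]; field_simp
  have hx : 0 ≤ (θ n α).re := le_trans (by positivity) hlo.le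
  have hxN : ℓ * (θ n α).re ≤ ((n : ℝ) + 1) * Real.pi := by
    rw [← hℓν]
    nlinarith [mul_le_mul_of_nonneg_left hhi.le hℓ.le]
  have hexp : Real.exp (2 * ℓ * -(θ n α).im) ≤ 100 * ((n : ℝ) + 1) ^ 2 := by
    refine exp_le_of_modulus_eq hℓ (neg_pos.2 hy) hα hx (by linarith) hxN ?_
    rw [neg_sq]
    exact exp_mul_sq_eq_of_dispersion (heq n α hα)
  have hpow : 100 * ((n : ℝ) + 1) ^ 2 ≤ (n : ℝ) ^ 10 := by
    have h8 : (2 : ℝ) ^ 8 ≤ (n : ℝ) ^ 8 := by gcongr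
    calc 100 * ((n : ℝ) + 1) ^ 2 ≤ 2 ^ 8 * (n : ℝ) ^ 2 := by nlinarith
      _ ≤ (n : ℝ) ^ 8 * (n : ℝ) ^ 2 := by gcongr
      _ = (n : ℝ) ^ 10 := by ring
  have hle := (Real.le_log_iff_exp_le (by positivity)).2 (hexp.trans hpow)
  rw [Real.log_pow] at hle
  rw [abs_of_neg hy, div_mul_eq_mul_div, le_div_iff₀ hℓ]
  push_cast at hle
  linarith
end

section
/- (Proposition B.1(iv), real part) For every β ∈ ℝ one has Re(θ_n(nν + β·ln n)) − nν → ν·(1 − arg(β + i/ℓ)/π) as n → ∞, where arg(β + i/ℓ) denotes the principal argument of β + i/ℓ, which lies in (0,π). (For all sufficiently large n one has nν + β·ln n > 0, so the expression is eventually well defined.) -/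
open Filter Topology

/-- If `a * exp (ℓ y) = b`, where `a` lies between `y` and `y + O(log n)` and `b` has order `n` up
to an error `y`, then `y` is asymptotic to `log n / ℓ`. -/
lemma tendsto_div_log_of_mul_exp_eq {ℓ c D K : ℝ} (hℓ : 0 < ℓ) (hc : 0 < c) (hD : 0 < D)
    (hK : 0 < K) {y a b : ℕ → ℝ}
    (hya : ∀ᶠ n in atTop, y n ≤ a n)
    (hay : ∀ᶠ n : ℕ in atTop, a n ≤ D * Real.log n + y n)
    (hcb : ∀ᶠ n : ℕ in atTop, c * n ≤ b n)
    (hbK : ∀ᶠ n : ℕ in atTop, b n ≤ K * n + y n)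
    (hab : ∀ᶠ n in atTop, a n * Real.exp (ℓ * y n) = b n) :
    Tendsto (fun n : ℕ => y n / Real.log n) atTop (𝓝 (1 / ℓ)) := by
  have hlog : Tendsto (fun n : ℕ => Real.log n) atTop atTop :=
    Real.tendsto_log_atTop.comp tendsto_natCast_atTop_atTop
  set M : ℝ := ℓ + Real.log (K + 1) with hM
  have hlogK : 0 ≤ Real.log (K + 1) := Real.log_nonneg (by linarith)
  have hM0 : 0 < M := by positivity
  set C : ℝ := D + (1 + M) / ℓ with hC
  have hC0 : 0 < C := by positivity
  have hupper : ∀ᶠ n : ℕ in atTop, ℓ * y n ≤ Real.log n + M := by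
    filter_upwards [hya, hbK, hab, hlog.eventually_ge_atTop 1, eventually_ge_atTop 1]
      with n h1 h2 h3 h4 h5
    have hn : (1 : ℝ) ≤ n := by exact_mod_cast h5
    rcases le_total (y n) 1 with h | h
    · nlinarith
    · have he : Real.exp (ℓ * y n) ≤ (K + 1) * n := by
        have h6 : y n * Real.exp (ℓ * y n) ≤ K * n + y n :=
          (mul_le_mul_of_nonneg_right h1 (Real.exp_pos _).le).trans (h3.le.trans h2)
        have hKn : 0 < K * n := by positivity
        by_contra! h7
        nlinarith [mul_lt_mul_of_pos_left h7 (show 0 < y n by linarith)]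
      have := (Real.le_log_iff_exp_le (by positivity)).2 he
      rw [Real.log_mul (by positivity) (by positivity)] at this
      linarith
  have hlower : ∀ᶠ n : ℕ in atTop,
      Real.log n + (Real.log c - Real.log C) - Real.log (Real.log n) ≤ ℓ * y n := by
    filter_upwards [hay, hcb, hab, hupper, hlog.eventually_ge_atTop 1, eventually_ge_atTop 1]
      with n h1 h2 h3 h4 h5 h6
    have hn : (1 : ℝ) ≤ n := by exact_mod_cast h6
    have haC : a n ≤ C * Real.log n := by
      have : y n ≤ (1 + M) / ℓ * Real.log n := by
        rw [div_mul_eq_mul_div, le_div_iff₀ hℓ]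
        nlinarith
      rw [hC, add_mul]
      linarith
    have h7 : c * n ≤ C * Real.log n * Real.exp (ℓ * y n) :=
      h2.trans (h3.symm.le.trans (mul_le_mul_of_nonneg_right haC (Real.exp_pos _).le))
    have h8 := Real.log_le_log (by positivity) h7
    rw [Real.log_mul (by positivity) (by positivity), Real.log_mul (by positivity) (by positivity),
      Real.log_mul (by positivity) (by positivity), Real.log_exp] at h8
    linarith
  have hinv : ∀ r : ℝ, Tendsto (fun n : ℕ => r / Real.log n) atTop (𝓝 0) :=
    fun r => tendsto_const_nhds.div_atTop hlog
  have hloglog : Tendsto (fun n : ℕ => Real.log (Real.log n) / Real.log n) atTop (𝓝 0) :=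
    (Real.isLittleO_log_id_atTop.tendsto_div_nhds_zero).comp hlog
  have hl : Tendsto (fun n : ℕ => (1 + (Real.log c - Real.log C) / Real.log n
      - Real.log (Real.log n) / Real.log n) / ℓ) atTop (𝓝 (1 / ℓ)) := by
    simpa using (((hinv _).const_add 1).sub hloglog).div_const ℓ
  have hu : Tendsto (fun n : ℕ => (1 + M / Real.log n) / ℓ) atTop (𝓝 (1 / ℓ)) := by
    simpa using ((hinv M).const_add 1).div_const ℓ
  refine tendsto_of_tendsto_of_tendsto_of_le_of_le' hl hu ?_ ?_
  · filter_upwards [hlower, hlog.eventually_ge_atTop 1] with n h h1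
    have : 0 < Real.log n := by linarith
    rw [div_le_div_iff₀ hℓ this]
    field_simp
    linarith
  · filter_upwards [hupper, hlog.eventually_ge_atTop 1] with n h h1
    have : 0 < Real.log n := by linarith
    rw [div_le_div_iff₀ this hℓ]
    field_simp
    linarith

/-- For `w` in the upper half-plane, `-r / w ^ 2` has argument `π - 2 arg w`. -/
lemma arg_neg_div_sq {r : ℝ} (hr : 0 < r) {w : ℂ} (hw : 0 < w.im) :
    -(r / w ^ 2 : ℂ) ∈ Complex.slitPlane ∧
      Complex.arg (-(r / w ^ 2 : ℂ)) = Real.pi - 2 * Complex.arg w := by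
  have hw0 : w ≠ 0 := fun h => by simp [h] at hw
  have hn : 0 < ‖w‖ := norm_pos_iff.2 hw0
  have ha0 : 0 < w.arg := lt_of_le_of_ne (Complex.arg_nonneg_iff.2 hw.le)
    (fun h => hw.ne' (Complex.arg_eq_zero_iff.1 h.symm).2)
  have haπ : w.arg < Real.pi := lt_of_le_of_ne (Complex.arg_le_pi w)
    (fun h => hw.ne' (Complex.arg_eq_pi_iff.1 h).2)
  have key : -(r / w ^ 2 : ℂ) = ((r / ‖w‖ ^ 2 : ℝ) : ℂ) *
      Complex.exp ((Real.pi - 2 * w.arg : ℝ) * Complex.I) := by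
    conv_lhs => rw [← Complex.norm_mul_exp_arg_mul_I w]
    have : ((Real.pi - 2 * w.arg : ℝ) * Complex.I : ℂ) =
        Real.pi * Complex.I - 2 * (w.arg * Complex.I) := by push_cast; ring
    rw [this, Complex.exp_sub, Complex.exp_pi_mul_I, two_mul, Complex.exp_add, ← sq, mul_pow]
    push_cast
    have : (‖w‖ : ℂ) ≠ 0 := by exact_mod_cast hn.ne'
    field_simp
  have harg : Complex.arg (-(r / w ^ 2 : ℂ)) = Real.pi - 2 * w.arg := by
    rw [key, Complex.arg_real_mul _ (by positivity), Complex.arg_exp_mul_I,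
      toIocMod_eq_self]
    constructor <;> linarith
  refine ⟨Complex.mem_slitPlane_iff_arg.2 ⟨?_, ?_⟩, harg⟩
  · rw [harg]; linarith
  · rw [neg_ne_zero]
    exact div_ne_zero (by exact_mod_cast hr.ne') (pow_ne_zero 2 hw0)

theorem stmt_4 (ℓ : ℝ) (hℓ : 0 < ℓ) (ν : ℝ) (hν : ν = Real.pi / ℓ)
    (θ : ℕ → ℝ → ℂ)
    (hcont : ∀ n : ℕ, ContinuousOn (θ n) (Set.Ici 0))
    (hdiff : ∀ n : ℕ, ∀ α : ℝ, 0 < α → DifferentiableAt ℝ (θ n) α)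
    (h0 : ∀ n : ℕ, θ n 0 = ((n * ν : ℝ) : ℂ))
    (heq : ∀ n : ℕ, ∀ α : ℝ, 0 ≤ α →
      ((α : ℂ) - θ n α) ^ 2 * Complex.exp (2 * Complex.I * (ℓ : ℂ) * θ n α)
        = ((α : ℂ) + θ n α) ^ 2)
    (hre : ∀ n : ℕ, ∀ α : ℝ, 0 < α →
      (θ n α).re ∈ Set.Ioo ((n : ℝ) * ν) (((n : ℝ) + 1) * ν))
    (him : ∀ n : ℕ, ∀ α : ℝ, 0 < α → (θ n α).im < 0)
    (hbd : ∀ n : ℕ, ∃ C : ℝ, 0 < C ∧ ∀ α : ℝ, 0 < α → -C ≤ (θ n α).im) :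
    ∀ β : ℝ,
      Filter.Tendsto
        (fun n : ℕ => (θ n ((n : ℝ) * ν + β * Real.log n)).re - (n : ℝ) * ν)
        Filter.atTop
        (nhds (ν * (1 - Complex.arg ((β : ℂ) + Complex.I / (ℓ : ℂ)) / Real.pi))) := by
  intro β
  have hν0 : 0 < ν := hν ▸ div_pos Real.pi_pos hℓ
  have hℓν : ℓ * ν = Real.pi := by rw [hν]; field_simp
  have hlog : Tendsto (fun n : ℕ => Real.log n) atTop atTop :=
    Real.tendsto_log_atTop.comp tendsto_natCast_atTop_atTop
  have hlogdiv : Tendsto (fun n : ℕ => Real.log n / n) atTop (𝓝 0) :=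
    (Real.isLittleO_log_id_atTop.tendsto_div_nhds_zero).comp tendsto_natCast_atTop_atTop
  set α : ℕ → ℝ := fun n => n * ν + β * Real.log n with hα
  set x : ℕ → ℝ := fun n => (θ n (α n)).re - n * ν with hx
  set y : ℕ → ℝ := fun n => -(θ n (α n)).im with hy
  have hθ : ∀ n, θ n (α n) = n * ν + x n - y n * Complex.I := fun n => by
    apply Complex.ext <;> simp [hx, hy]
  have hαpos : ∀ᶠ n in atTop, 0 < α n := by
    have h : Tendsto (fun n : ℕ => ν + β * (Real.log n / n)) atTop (𝓝 ν) := by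
      simpa using (hlogdiv.const_mul β).const_add ν
    filter_upwards [h.eventually_const_lt hν0, eventually_ge_atTop 1] with n h1 h2
    have hn : (0 : ℝ) < n := by exact_mod_cast h2
    have : α n = n * (ν + β * (Real.log n / n)) := by simp only [hα]; field_simp
    rw [this]
    positivity
  have hxmem : ∀ᶠ n in atTop, 0 < x n ∧ x n < ν := hαpos.mono fun n h => by
    obtain ⟨h1, h2⟩ := hre n _ h
    simp only [hx]
    constructor <;> linarith
  have hypos : ∀ᶠ n in atTop, 0 < y n := hαpos.mono fun n h => neg_pos.2 (him n _ h)
  have hexp : ∀ n, Complex.exp (2 * Complex.I * ℓ * θ n (α n)) =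
      (Real.exp (ℓ * y n) ^ 2 : ℝ) * Complex.exp ((2 * ℓ * x n : ℝ) * Complex.I) := fun n => by
    have hℓν' : (ℓ : ℂ) * ν = Real.pi := by exact_mod_cast hℓν
    have : 2 * Complex.I * ℓ * θ n (α n) =
        n * (2 * Real.pi * Complex.I) + (2 * (ℓ * y n) + (2 * ℓ * x n : ℝ) * Complex.I) := by
      rw [hθ, ← hℓν']
      push_cast
      linear_combination (-2 * ℓ * y n : ℂ) * Complex.I_sq
    rw [this, Complex.exp_add, Complex.exp_nat_mul_two_pi_mul_I, one_mul, Complex.exp_add,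
      two_mul (_ * _ : ℂ), Complex.exp_add, ← sq]
    push_cast
    rfl
  have hsub : ∀ n, (α n : ℂ) - θ n (α n) = (β * Real.log n - x n : ℝ) + y n * Complex.I :=
    fun n => by rw [hθ]; simp only [hα]; push_cast; ring
  have hadd : ∀ n, (α n : ℂ) + θ n (α n) =
      (2 * n * ν + β * Real.log n + x n : ℝ) - y n * Complex.I :=
    fun n => by rw [hθ]; simp only [hα]; push_cast; ring
  have hnorm : ∀ᶠ n in atTop, ‖(α n : ℂ) - θ n (α n)‖ * Real.exp (ℓ * y n) =
      ‖(α n : ℂ) + θ n (α n)‖ := hαpos.mono fun n h => by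
    have := congrArg norm (heq n _ h.le)
    rw [hexp, norm_mul, norm_mul, Complex.norm_exp_ofReal_mul_I, mul_one, norm_pow, norm_pow,
      Complex.norm_of_nonneg (by positivity), ← mul_pow] at this
    exact (pow_left_inj₀ (by positivity) (by positivity) two_ne_zero).1 this
  have hylog : Tendsto (fun n : ℕ => y n / Real.log n) atTop (𝓝 (1 / ℓ)) := by
    refine tendsto_div_log_of_mul_exp_eq hℓ hν0 (D := |β| + ν) (K := 3 * ν + |β|)
      (by positivity) (by positivity) ?_ ?_ ?_ ?_ hnorm
    · filter_upwards [hypos] with n h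
      have := Complex.im_le_norm ((α n : ℂ) - θ n (α n))
      simpa [hy] using this
    · filter_upwards [hypos, hxmem, hlog.eventually_ge_atTop 1] with n h h1 h2
      rw [hsub]
      refine (norm_add_le _ _).trans ?_
      rw [norm_mul, Complex.norm_I, mul_one, Complex.norm_real, Complex.norm_real,
        Real.norm_of_nonneg h.le, Real.norm_eq_abs]
      have := abs_sub (β * Real.log n) (x n)
      rw [abs_mul, abs_of_nonneg (show 0 ≤ Real.log n by linarith), abs_of_pos h1.1] at this
      nlinarith
    · filter_upwards [hαpos, hxmem] with n h h1
      refine le_trans ?_ (Complex.re_le_norm _)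
      have : (θ n (α n)).re = x n + n * ν := by simp [hx]
      rw [Complex.add_re, Complex.ofReal_re, this]
      linarith
    · filter_upwards [hypos, hxmem, hlog.eventually_ge_atTop 1, eventually_ge_atTop 1]
        with n h h1 h2 h3
      have hn : (1 : ℝ) ≤ n := by exact_mod_cast h3
      have hln : Real.log n ≤ n := Real.log_le_self (by positivity)
      rw [hadd]
      refine (norm_sub_le _ _).trans ?_
      rw [norm_mul, Complex.norm_I, mul_one, Complex.norm_real, Complex.norm_real,
        Real.norm_of_nonneg h.le, Real.norm_eq_abs]
      have h4 := abs_add_three (2 * n * ν) (β * Real.log n) (x n)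
      rw [abs_mul β, abs_of_nonneg (show 0 ≤ Real.log n by linarith), abs_of_pos h1.1,
        abs_of_nonneg (show 0 ≤ 2 * n * ν by positivity)] at h4
      nlinarith [abs_nonneg β]
  have hxlog : Tendsto (fun n : ℕ => x n / Real.log n) atTop (𝓝 0) := by
    refine tendsto_of_tendsto_of_tendsto_of_le_of_le' tendsto_const_nhds
      ((tendsto_const_nhds (x := ν)).div_atTop hlog) ?_ ?_ <;>
    filter_upwards [hxmem, hlog.eventually_ge_atTop 1] with n h h1
    · exact div_nonneg h.1.le (by linarith)
    · exact div_le_div_of_nonneg_right h.2.le (by linarith)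
  have ofReal {f : ℕ → ℝ} {a : ℝ} (h : Tendsto f atTop (𝓝 a)) :
      Tendsto (fun n => (f n : ℂ)) atTop (𝓝 (a : ℂ)) :=
    (Complex.continuous_ofReal.tendsto a).comp h
  set w : ℂ := (β : ℂ) + Complex.I / (ℓ : ℂ) with hw
  have hwim : 0 < w.im := by
    have : w.im = 1 / ℓ := by simp [hw, Complex.div_ofReal_im]
    rw [this]; positivity
  have hw0 : w ≠ 0 := fun h => by simp [h] at hwim
  have hlimsub : Tendsto (fun n : ℕ => ((α n : ℂ) - θ n (α n)) / Real.log n) atTop (𝓝 w) := by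
    have h := (ofReal (hxlog.const_sub β)).add ((ofReal hylog).mul_const Complex.I)
    have e : ((β - 0 : ℝ) : ℂ) + ((1 / ℓ : ℝ) : ℂ) * Complex.I = w := by
      rw [hw]; push_cast; ring
    rw [e] at h
    refine h.congr' ?_
    filter_upwards [hlog.eventually_ge_atTop 1] with n h1
    have : (Real.log n : ℂ) ≠ 0 := by exact_mod_cast (by linarith : Real.log n ≠ 0)
    rw [hsub]
    push_cast at this ⊢
    field_simp
  have hlimadd : Tendsto (fun n : ℕ => ((α n : ℂ) + θ n (α n)) / n) atTop
      (𝓝 ((2 * ν : ℝ) : ℂ)) := by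
    have h := (ofReal (((hxlog.const_add β).mul hlogdiv).const_add (2 * ν))).sub
      ((ofReal (hylog.mul hlogdiv)).mul_const Complex.I)
    simp only [mul_zero, add_zero, Complex.ofReal_zero, zero_mul, sub_zero] at h
    refine h.congr' ?_
    filter_upwards [hlog.eventually_ge_atTop 1, eventually_ge_atTop 1] with n h1 h2
    have : (Real.log n : ℂ) ≠ 0 := by exact_mod_cast (by linarith : Real.log n ≠ 0)
    have hn : (n : ℂ) ≠ 0 := by exact_mod_cast (by lia : n ≠ 0)
    rw [hadd]
    push_cast at this ⊢
    field_simp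
    ring
  obtain ⟨hslit, harg⟩ := arg_neg_div_sq (r := (2 * ν) ^ 2) (by positivity) hwim
  have hlim := ((hlimadd.pow 2).div (hlimsub.pow 2) (pow_ne_zero 2 hw0)).neg
  rw [← Complex.ofReal_pow] at hlim
  have hlimarg := (Complex.continuousAt_arg hslit).tendsto.comp hlim
  rw [harg] at hlimarg
  have hxarg : Tendsto (fun n => 2 * ℓ * x n - Real.pi) atTop
      (𝓝 (Real.pi - 2 * w.arg)) := by
    refine hlimarg.congr' ?_
    filter_upwards [hαpos, hypos, hxmem, hlog.eventually_ge_atTop 1, eventually_ge_atTop 1]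
      with n h h0 h1 h2 h3
    have hn : (0 : ℝ) < n := by exact_mod_cast h3
    have hL : (0 : ℝ) < Real.log n := by linarith
    have hs0 : (α n : ℂ) - θ n (α n) ≠ 0 := fun h4 => by
      have := congrArg Complex.im h4
      simp [hy] at this h0
      linarith
    have e : -((((α n : ℂ) + θ n (α n)) / n) ^ 2 / (((α n : ℂ) - θ n (α n)) / Real.log n) ^ 2) =
        ((Real.exp (ℓ * y n) ^ 2 * (Real.log n / n) ^ 2 : ℝ) : ℂ) *
          Complex.exp ((2 * ℓ * x n - Real.pi : ℝ) * Complex.I) := by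
      have e1 : (((2 * ℓ * x n - Real.pi : ℝ) : ℂ) * Complex.I) =
          (2 * ℓ * x n : ℝ) * Complex.I - Real.pi * Complex.I := by push_cast; ring
      rw [div_pow, div_pow, ← heq n _ h.le, hexp, e1, Complex.exp_sub, Complex.exp_pi_mul_I]
      have hnc : (n : ℂ) ≠ 0 := by exact_mod_cast hn.ne'
      have hLc : (Real.log n : ℂ) ≠ 0 := by exact_mod_cast hL.ne'
      push_cast
      field_simp
    have hm : 0 < ℓ * x n := mul_pos hℓ h1.1
    have hm' : ℓ * x n < Real.pi := hℓν ▸ mul_lt_mul_of_pos_left h1.2 hℓ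
    simp only [Function.comp_apply, Pi.div_apply, e]
    rw [Complex.arg_real_mul _ (by positivity), Complex.arg_exp_mul_I, toIocMod_eq_self]
    constructor <;> linarith
  have hfin := (hxarg.add_const Real.pi).div_const (2 * ℓ)
  convert hfin using 2
  · field_simp
    ring
  · rw [hν]
    have := Real.pi_ne_zero
    field_simp
    ring
end

section
/- (Proposition B.1(iv), imaginary part) For every β ∈ ℝ one has −Im(θ_n(nν + β·ln n)) ∼ ln(n)/ℓ as n → ∞; equivalently, −ℓ·Im(θ_n(nν + β·ln n))/ln(n) → 1 as n → ∞. (For all sufficiently large n one has nν + β·ln n > 0, so the expression is eventually well defined.) -/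
/-- Taking squared moduli in the dispersion relation `(a - z)² exp (2iℓz) = (a + z)²`. -/
theorem exp_mul_normSq_eq_of_dispersion {ℓ a : ℝ} {z : ℂ}
    (h : ((a : ℂ) - z) ^ 2 * Complex.exp (2 * Complex.I * (ℓ : ℂ) * z) = ((a : ℂ) + z) ^ 2) :
    Real.exp (2 * (-ℓ * z.im)) * ((z.re - a) ^ 2 + z.im ^ 2) = (a + z.re) ^ 2 + z.im ^ 2 := by
  have h1 := congrArg norm h
  rw [norm_mul, norm_pow, norm_pow, Complex.norm_exp, Complex.sq_norm, Complex.sq_norm,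
    Complex.normSq_apply, Complex.normSq_apply] at h1
  have h2 : (2 * Complex.I * (ℓ : ℂ) * z).re = 2 * (-ℓ * z.im) := by
    simp [mul_assoc]
  rw [h2] at h1
  simp only [Complex.sub_re, Complex.sub_im, Complex.add_re, Complex.add_im,
    Complex.ofReal_re, Complex.ofReal_im] at h1
  linear_combination h1

theorem lt_of_exp_mul_eq_of_le {ℓ A D K L t N δ : ℝ} (hℓ : 0 < ℓ) (hL : 1 ≤ L) (hδ : 0 ≤ δ)
    (hA : A ^ 2 ≤ K * N ^ 2) (hN : N = Real.exp L)
    (hK : K * ℓ ^ 2 + 1 < Real.exp (2 * δ))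
    (h : Real.exp (2 * (ℓ * t)) * (D ^ 2 + t ^ 2) = A ^ 2 + t ^ 2) :
    ℓ * t < L + δ := by
  by_contra! hc
  have hN1 : 1 ≤ N := hN ▸ Real.one_le_exp (by linarith)
  have hs : 1 ≤ (ℓ * t) ^ 2 := by nlinarith
  have hE : N ^ 2 * Real.exp (2 * δ) ≤ Real.exp (2 * (ℓ * t)) := by
    rw [hN, ← Real.exp_nat_mul, ← Real.exp_add]
    exact Real.exp_le_exp.2 (by push_cast; linarith)
  have h1 : N ^ 2 * (K * ℓ ^ 2 + 1) < Real.exp (2 * (ℓ * t)) :=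
    (mul_lt_mul_of_pos_left hK (by positivity)).trans_le hE
  have hK0 : 0 ≤ K * N ^ 2 := (sq_nonneg A).trans hA
  have h2 : (Real.exp (2 * (ℓ * t)) - 1) * (ℓ * t) ^ 2 ≤ K * N ^ 2 * ℓ ^ 2 := by
    have : (Real.exp (2 * (ℓ * t)) - 1) * t ^ 2 ≤ K * N ^ 2 := by
      have := mul_nonneg (Real.exp_pos (2 * (ℓ * t))).le (sq_nonneg D)
      linarith
    nlinarith [sq_nonneg ℓ]
  have h3 : 0 ≤ K * N ^ 2 * ℓ ^ 2 := by positivity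
  have h4 : K * N ^ 2 * ℓ ^ 2 < Real.exp (2 * (ℓ * t)) - 1 := by
    have : 1 ≤ N ^ 2 := one_le_pow₀ hN1
    linarith
  have h5 := le_mul_of_one_le_right (h3.trans h4.le) hs
  linarith

theorem lt_of_exp_mul_eq_of_ge {ℓ A D M L t N δ : ℝ} (ht : 0 < t) (hℓ : 0 < ℓ) (hδ : 0 ≤ δ)
    (hA : M * N ^ 2 ≤ A ^ 2) (hN : N = Real.exp L)
    (hM : D ^ 2 + (L / ℓ) ^ 2 < M * Real.exp (2 * δ))
    (h : Real.exp (2 * (ℓ * t)) * (D ^ 2 + t ^ 2) = A ^ 2 + t ^ 2) :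
    L - δ < ℓ * t := by
  by_contra! hc
  have htL : t ≤ L / ℓ := by rw [le_div_iff₀ hℓ]; linarith
  have hE : Real.exp (2 * (ℓ * t)) * Real.exp (2 * δ) ≤ N ^ 2 := by
    rw [hN, ← Real.exp_nat_mul, ← Real.exp_add]
    exact Real.exp_le_exp.2 (by push_cast; linarith)
  have hD : D ^ 2 + t ^ 2 < M * Real.exp (2 * δ) := by
    have := pow_le_pow_left₀ ht.le htL 2
    linarith
  have h1 := mul_lt_mul_of_pos_left hD (Real.exp_pos (2 * (ℓ * t)))
  have hM0 : 0 ≤ M := by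
    have : 0 < M * Real.exp (2 * δ) := lt_of_le_of_lt (by positivity) hD
    exact (pos_of_mul_pos_left this (Real.exp_pos _).le).le
  have h2 := mul_le_mul_of_nonneg_left hE hM0
  nlinarith [sq_nonneg t]

open Filter in
theorem eventually_mul_lt_mul_exp {b c : ℝ} (hc : 0 < c) :
    ∀ᶠ L : ℝ in atTop, b * L < c * Real.exp L := by
  have h := (Real.tendsto_pow_mul_exp_neg_atTop_nhds_zero 1).const_mul b
  rw [mul_zero] at h
  filter_upwards [h.eventually_lt_const hc] with L hL
  rw [pow_one, Real.exp_neg, ← mul_assoc, ← div_eq_mul_inv, div_lt_iff₀ (Real.exp_pos L)] at hL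
  exact hL

open Filter in
theorem eventually_sq_add_sq_lt_mul_exp {a b d c ε : ℝ} (hc : 0 < c) (hε : 0 < ε) :
    ∀ᶠ L : ℝ in atTop, (a + b * L) ^ 2 + (L / d) ^ 2 < c * Real.exp (2 * (ε * L)) := by
  have h : (fun L : ℝ => (a + b * L) ^ 2 + (L / d) ^ 2) =o[atTop]
      fun L => Real.exp (2 * ε * L) := by
    have hp (k : ℕ) := isLittleO_pow_exp_pos_mul_atTop k (b := 2 * ε) (by positivity)
    have := (((hp 0).const_mul_left (a ^ 2)).add ((hp 1).const_mul_left (2 * a * b))).add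
      ((hp 2).const_mul_left (b ^ 2 + (d⁻¹) ^ 2))
    refine this.congr_left fun L => ?_
    ring
  filter_upwards [h.bound (half_pos hc)] with L hL
  rw [Real.norm_of_nonneg (by positivity), Real.norm_of_nonneg (by positivity), mul_assoc] at hL
  have := mul_pos hc (Real.exp_pos (2 * (ε * L)))
  linarith


theorem stmt_5 (ℓ : ℝ) (hℓ : 0 < ℓ) (ν : ℝ) (hν : ν = Real.pi / ℓ)
    (θ : ℕ → ℝ → ℂ)
    (hcont : ∀ n : ℕ, ContinuousOn (θ n) (Set.Ici 0))
    (hdiff : ∀ n : ℕ, ∀ α : ℝ, 0 < α → DifferentiableAt ℝ (θ n) α)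
    (h0 : ∀ n : ℕ, θ n 0 = ((n * ν : ℝ) : ℂ))
    (heq : ∀ n : ℕ, ∀ α : ℝ, 0 ≤ α →
      ((α : ℂ) - θ n α) ^ 2 * Complex.exp (2 * Complex.I * (ℓ : ℂ) * θ n α)
        = ((α : ℂ) + θ n α) ^ 2)
    (hre : ∀ n : ℕ, ∀ α : ℝ, 0 < α →
      (θ n α).re ∈ Set.Ioo ((n : ℝ) * ν) (((n : ℝ) + 1) * ν))
    (him : ∀ n : ℕ, ∀ α : ℝ, 0 < α → (θ n α).im < 0)
    (hbd : ∀ n : ℕ, ∃ C : ℝ, 0 < C ∧ ∀ α : ℝ, 0 < α → -C ≤ (θ n α).im) :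
    ∀ β : ℝ,
      Filter.Tendsto
        (fun n : ℕ => -ℓ * (θ n ((n : ℝ) * ν + β * Real.log n)).im / Real.log n)
        Filter.atTop (nhds 1) := by
  intro β
  have hν0 : 0 < ν := hν ▸ div_pos Real.pi_pos hℓ
  rw [Metric.tendsto_nhds]
  intro ε hε
  have hlog : Filter.Tendsto (fun n : ℕ => Real.log n) Filter.atTop Filter.atTop :=
    Real.tendsto_log_atTop.comp tendsto_natCast_atTop_atTop
  have hexp : Filter.Tendsto (fun L : ℝ => Real.exp (2 * (ε * L))) Filter.atTop Filter.atTop :=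
    Real.tendsto_exp_atTop.comp
      ((Filter.tendsto_id.const_mul_atTop hε).const_mul_atTop two_pos)
  filter_upwards [Filter.eventually_ge_atTop 1, hlog.eventually_ge_atTop 1,
    hlog.eventually (eventually_mul_lt_mul_exp (b := |β|) hν0),
    hlog.eventually (hexp.eventually_gt_atTop (16 * ν ^ 2 * ℓ ^ 2 + 1)),
    hlog.eventually (eventually_sq_add_sq_lt_mul_exp (a := ν) (b := |β|) (d := ℓ)
      (sq_pos_of_pos hν0) hε)] with n hn hL hβ hK hM
  have hn1 : (1 : ℝ) ≤ n := by exact_mod_cast hn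
  have hN : (n : ℝ) = Real.exp (Real.log n) := (Real.exp_log (by linarith)).symm
  rw [← hN] at hβ
  generalize Real.log n = L at *
  have hβL : |β * L| = |β| * L := by rw [abs_mul, abs_of_nonneg (by linarith : 0 ≤ L)]
  obtain ⟨hβ1, hβ2⟩ := abs_le.1 hβL.le
  have hα : 0 < (n : ℝ) * ν + β * L := by linarith
  obtain ⟨hx1, hx2⟩ := hre n _ hα
  have hy := him n _ hα
  have h := exp_mul_normSq_eq_of_dispersion (heq n _ hα.le)
  generalize θ n ((n : ℝ) * ν + β * L) = z at *
  rw [← neg_sq z.im, neg_mul_comm] at h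
  have hνn : ν ≤ n * ν := le_mul_of_one_le_left hν0.le hn1
  have hup := lt_of_exp_mul_eq_of_le (K := 16 * ν ^ 2) hℓ hL (by positivity)
    (by
      calc _ ≤ (4 * (n * ν)) ^ 2 := pow_le_pow_left₀ (by linarith) (by linarith) 2
        _ = _ := by ring) hN hK h
  have hD : (z.re - (n * ν + β * L)) ^ 2 ≤ (ν + |β| * L) ^ 2 :=
    sq_le_sq' (by linarith) (by linarith)
  have hlo := lt_of_exp_mul_eq_of_ge (M := ν ^ 2) (δ := ε * L) (neg_pos.2 hy) hℓ (by positivity)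
    (by
      calc _ = (n * ν) ^ 2 := by ring
        _ ≤ _ := pow_le_pow_left₀ (by positivity) (by linarith) 2) hN
    (by linarith) h
  have hL0 : 0 < L := by linarith
  rw [Real.dist_eq, div_sub_one hL0.ne', abs_div, abs_of_pos hL0, div_lt_iff₀ hL0, abs_lt]
  constructor <;> linarith
end

section
/- (Proposition B.1(v), imaginary part) For every γ ∈ (0,∞) with γ ≠ 1 one has Im(θ_n(γ·nν)) → −(1/ℓ)·ln|(1+γ)/(1−γ)| as n → ∞. -/
open Filter Topology

lemma exp_eq_div_of_mul_exp_eq {ℓ a : ℝ} {z : ℂ} (hz : z.im < 0)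
    (h : ((a : ℂ) - z) ^ 2 * Complex.exp (2 * Complex.I * (ℓ : ℂ) * z) = ((a : ℂ) + z) ^ 2) :
    Real.exp (-(2 * ℓ * z.im)) =
      ((a + z.re) ^ 2 + z.im ^ 2) / ((a - z.re) ^ 2 + z.im ^ 2) := by
  have hn := congrArg norm h
  have hre : (2 * Complex.I * (ℓ : ℂ) * z).re = -(2 * ℓ * z.im) := by
    simp [Complex.mul_re, Complex.mul_im]
  rw [norm_mul, norm_pow, norm_pow, Complex.norm_exp, hre, ← Complex.normSq_eq_norm_sq,
    ← Complex.normSq_eq_norm_sq, Complex.normSq_apply, Complex.normSq_apply] at hn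
  simp only [Complex.sub_re, Complex.sub_im, Complex.add_re, Complex.add_im,
    Complex.ofReal_re, Complex.ofReal_im] at hn
  have hpos : 0 < (a - z.re) ^ 2 + z.im ^ 2 := by
    have := pow_pos (neg_pos.2 hz) 2
    nlinarith [sq_nonneg (a - z.re)]
  rw [eq_div_iff hpos.ne']
  linear_combination hn

lemma add_div_add_le_div {a b c : ℝ} (hb : 0 < b) (hab : b ≤ a) (hc : 0 ≤ c) :
    (a + c) / (b + c) ≤ a / b := by
  rw [div_le_div_iff₀ (by linarith) hb]
  nlinarith

/-- If the real part is asymptotic to `N`, solutions of the transverse dispersion relation at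
`a = γ * N` have imaginary part converging to `-(1 / ℓ) * log |(1 + γ) / (1 - γ)|`. -/
lemma tendsto_im_of_mul_exp_eq {ℓ γ : ℝ} (hℓ : 0 < ℓ) (hγ : 0 < γ) (hγ1 : γ ≠ 1)
    {N : ℕ → ℝ} {z : ℕ → ℂ} (hN : Tendsto N atTop atTop)
    (hre : Tendsto (fun n => (z n).re / N n) atTop (𝓝 1))
    (him : ∀ᶠ n in atTop, (z n).im < 0)
    (heq : ∀ᶠ n in atTop, (((γ * N n : ℝ) : ℂ) - z n) ^ 2
      * Complex.exp (2 * Complex.I * (ℓ : ℂ) * z n) = (((γ * N n : ℝ) : ℂ) + z n) ^ 2) :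
    Tendsto (fun n => (z n).im) atTop (𝓝 (-(1 / ℓ) * Real.log |(1 + γ) / (1 - γ)|)) := by
  set s : ℕ → ℝ := fun n => (z n).re / N n with hs
  set τ : ℕ → ℝ := fun n => (z n).im / N n with hτ
  have hsub : γ - 1 ≠ 0 := sub_ne_zero.2 hγ1
  have hnum : Tendsto (fun n => (γ + s n) ^ 2) atTop (𝓝 ((γ + 1) ^ 2)) :=
    (tendsto_const_nhds.add hre).pow 2
  have hden : Tendsto (fun n => (γ - s n) ^ 2) atTop (𝓝 ((γ - 1) ^ 2)) :=
    (tendsto_const_nhds.sub hre).pow 2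
  have hL : (γ + 1) ^ 2 / (γ - 1) ^ 2 ≠ 0 := by positivity
  have hlogq := (hnum.div hden (pow_ne_zero 2 hsub)).log hL
  have hexp : ∀ᶠ n in atTop, Real.exp (-(2 * ℓ * (z n).im)) =
      ((γ + s n) ^ 2 + τ n ^ 2) / ((γ - s n) ^ 2 + τ n ^ 2) := by
    filter_upwards [him, heq, hN.eventually_gt_atTop 0] with n h1 h2 h3
    rw [exp_eq_div_of_mul_exp_eq h1 h2,
      ← mul_div_mul_left ((γ + s n) ^ 2 + τ n ^ 2) _ (pow_ne_zero 2 h3.ne')]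
    have e1 : (z n).re = N n * s n := by simp only [hs]; field_simp
    have e2 : (z n).im = N n * τ n := by simp only [hτ]; field_simp
    rw [e1, e2]
    congr 1 <;> ring
  have hbound : ∀ᶠ n in atTop,
      -(2 * ℓ * (z n).im) ≤ Real.log ((γ + s n) ^ 2 / (γ - s n) ^ 2) := by
    filter_upwards [hexp, hden.eventually_ne (pow_ne_zero 2 hsub),
      hre.eventually_const_lt one_pos] with n h1 h2 h3
    have hb : 0 < (γ - s n) ^ 2 := lt_of_le_of_ne (sq_nonneg _) h2.symm
    rw [← Real.log_exp (-(2 * ℓ * (z n).im)), h1]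
    have hle : (γ - s n) ^ 2 ≤ (γ + s n) ^ 2 := by nlinarith [mul_pos hγ h3]
    exact Real.log_le_log (by positivity) (add_div_add_le_div hb hle (sq_nonneg _))
  have hτ0 : Tendsto τ atTop (𝓝 0) := by
    have hlow := (hlogq.const_mul (-(1 / (2 * ℓ)))).div_atTop hN
    refine tendsto_of_tendsto_of_tendsto_of_le_of_le' hlow tendsto_const_nhds ?_ ?_
    · filter_upwards [hbound, hN.eventually_gt_atTop 0] with n h1 h3
      refine div_le_div_of_nonneg_right ?_ h3.le
      simp only [Pi.div_apply]
      rw [neg_mul, neg_le, one_div, inv_mul_eq_div, le_div_iff₀ (by positivity)]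
      linarith
    · filter_upwards [him, hN.eventually_gt_atTop 0] with n h1 h3
      exact (div_neg_of_neg_of_pos h1 h3).le
  have hlog : Tendsto
      (fun n => Real.log (((γ + s n) ^ 2 + τ n ^ 2) / ((γ - s n) ^ 2 + τ n ^ 2))) atTop
      (𝓝 (Real.log ((γ + 1) ^ 2 / (γ - 1) ^ 2))) := by
    have hτ2 : Tendsto (fun n => τ n ^ 2) atTop (𝓝 0) := by simpa using hτ0.pow 2
    have hnum' := hnum.add hτ2
    have hden' := hden.add hτ2
    rw [add_zero] at hnum' hden'
    exact (hnum'.div hden' (pow_ne_zero 2 hsub)).log hL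
  have hlim : -(1 / (2 * ℓ)) * Real.log ((γ + 1) ^ 2 / (γ - 1) ^ 2) =
      -(1 / ℓ) * Real.log |(1 + γ) / (1 - γ)| := by
    have hsq : (γ + 1) ^ 2 / (γ - 1) ^ 2 = ((1 + γ) / (1 - γ)) ^ 2 := by
      rw [div_pow]; congr 1 <;> ring
    rw [Real.log_abs, hsq, Real.log_pow]
    push_cast
    field_simp
  rw [← hlim]
  refine (hlog.const_mul _).congr' ?_
  filter_upwards [hexp] with n h1
  rw [← h1, Real.log_exp]
  field_simp


theorem stmt_6 (ℓ : ℝ) (hℓ : 0 < ℓ) (ν : ℝ) (hν : ν = Real.pi / ℓ)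
    (θ : ℕ → ℝ → ℂ)
    (hcont : ∀ n : ℕ, ContinuousOn (θ n) (Set.Ici 0))
    (hdiff : ∀ n : ℕ, ∀ α : ℝ, 0 < α → DifferentiableAt ℝ (θ n) α)
    (h0 : ∀ n : ℕ, θ n 0 = ((n * ν : ℝ) : ℂ))
    (heq : ∀ n : ℕ, ∀ α : ℝ, 0 ≤ α →
      ((α : ℂ) - θ n α) ^ 2 * Complex.exp (2 * Complex.I * (ℓ : ℂ) * θ n α)
        = ((α : ℂ) + θ n α) ^ 2)
    (hre : ∀ n : ℕ, ∀ α : ℝ, 0 < α →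
      (θ n α).re ∈ Set.Ioo ((n : ℝ) * ν) (((n : ℝ) + 1) * ν))
    (him : ∀ n : ℕ, ∀ α : ℝ, 0 < α → (θ n α).im < 0)
    (hbd : ∀ n : ℕ, ∃ C : ℝ, 0 < C ∧ ∀ α : ℝ, 0 < α → -C ≤ (θ n α).im) :
    ∀ γ : ℝ, 0 < γ → γ ≠ 1 →
      Filter.Tendsto (fun n : ℕ => (θ n (γ * (n : ℝ) * ν)).im) Filter.atTop
        (nhds (-(1 / ℓ) * Real.log |(1 + γ) / (1 - γ)|)) := by
  intro γ hγ hγ1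
  have hνpos : 0 < ν := hν ▸ div_pos Real.pi_pos hℓ
  have hα : ∀ n : ℕ, 0 < n → 0 < γ * (n : ℝ) * ν := fun n hn => by positivity
  refine tendsto_im_of_mul_exp_eq (N := fun n : ℕ => (n : ℝ) * ν) hℓ hγ hγ1
    (tendsto_natCast_atTop_atTop.atTop_mul_const hνpos) ?_ ?_ ?_
  · have hup : Tendsto (fun n : ℕ => 1 + 1 / (n : ℝ)) atTop (𝓝 1) := by
      simpa using tendsto_one_div_atTop_nhds_zero_nat.const_add (1 : ℝ)
    refine tendsto_of_tendsto_of_tendsto_of_le_of_le' tendsto_const_nhds hup ?_ ?_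
    · filter_upwards [eventually_gt_atTop 0] with n hn
      rw [le_div_iff₀ (by positivity), one_mul]
      exact (hre n _ (hα n hn)).1.le
    · filter_upwards [eventually_gt_atTop 0] with n hn
      rw [div_le_iff₀ (by positivity)]
      refine (hre n _ (hα n hn)).2.le.trans_eq ?_
      field_simp
  · filter_upwards [eventually_gt_atTop 0] with n hn
    exact him n _ (hα n hn)
  · filter_upwards [eventually_gt_atTop 0] with n hn
    rw [← mul_assoc]
    exact heq n _ (hα n hn).le
end

section
/- (Proposition B.1(v), real part) For every γ ∈ (0,∞) with γ ≠ 1: if γ < 1 then Re(θ_n(γ·nν)) − nν → 0 as n → ∞, and if γ > 1 then Re(θ_n(γ·nν)) − nν → ν as n → ∞. -/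
open Filter Topology in
/-- A complex sequence whose real part stays between `n * ν` and `(n + 1) * ν` and whose imaginary
part is bounded is asymptotic to `n * ν`. -/
theorem tendsto_div_natCast_mul_of_strip {ν C : ℝ} (hν : 0 < ν) {z : ℕ → ℂ}
    (hre : ∀ᶠ n : ℕ in atTop, (z n).re ∈ Set.Ioo (n * ν) ((n + 1) * ν))
    (him : ∀ᶠ n : ℕ in atTop, |(z n).im| ≤ C) :
    Tendsto (fun n : ℕ => z n / ((n * ν : ℝ) : ℂ)) atTop (𝓝 1) := by
  have hdiv : Tendsto (fun n : ℕ => (ν + C) / (n * ν)) atTop (𝓝 0) :=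
    (tendsto_natCast_atTop_atTop.atTop_mul_const hν).const_div_atTop (ν + C)
  rw [tendsto_iff_norm_sub_tendsto_zero]
  refine squeeze_zero' (Eventually.of_forall fun _ => norm_nonneg _) ?_ hdiv
  filter_upwards [hre, him, eventually_gt_atTop 0] with n hn hi hpos
  have hnν : 0 < (n : ℝ) * ν := by positivity
  have hne : ((n * ν : ℝ) : ℂ) ≠ 0 := by exact_mod_cast hnν.ne'
  rw [div_sub_one hne, norm_div, Complex.norm_real, Real.norm_of_nonneg hnν.le]
  gcongr
  refine (Complex.norm_le_abs_re_add_abs_im _).trans ?_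
  simp only [Complex.sub_re, Complex.sub_im, Complex.ofReal_re, Complex.ofReal_im, sub_zero]
  have : |(z n).re - n * ν| ≤ ν := by
    rw [abs_le]; constructor <;> nlinarith [hn.1, hn.2]
  linarith

/-- For real `α > 0`, the Möbius map `z ↦ (z + α) / (z - α)` sends the lower half plane to the
upper half plane. -/
theorem im_add_div_sub_pos {α : ℝ} (hα : 0 < α) {z : ℂ} (hz : z.im < 0) :
    0 < ((z + α) / (z - α)).im := by
  have hne : z - α ≠ 0 := fun h => by
    have := congrArg Complex.im h
    simp at this
    linarith
  have hN : 0 < Complex.normSq (z - α) := Complex.normSq_pos.2 hne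
  rw [Complex.div_im, ← sub_div]
  apply div_pos _ hN
  simp
  nlinarith [mul_pos hα (neg_pos.2 hz)]

theorem exp_I_mul_sub_eq_add_div_sub {ℓ α : ℝ} (hℓ : 0 < ℓ) (hα : 0 < α) {n : ℕ} {z : ℂ}
    (heq : ((α : ℂ) - z) ^ 2 * Complex.exp (2 * Complex.I * (ℓ : ℂ) * z) = ((α : ℂ) + z) ^ 2)
    (hre : z.re ∈ Set.Ioo (n * (Real.pi / ℓ)) ((n + 1) * (Real.pi / ℓ))) (him : z.im < 0) :
    Complex.exp (Complex.I * (ℓ * (z - (n * (Real.pi / ℓ) : ℝ)))) = (z + α) / (z - α) := by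
  set E := Complex.exp (Complex.I * (ℓ * (z - (n * (Real.pi / ℓ) : ℝ)))) with hE
  have hne : z - α ≠ 0 := fun h => by
    have := congrArg Complex.im h
    simp at this
    linarith
  have hℓ' : (ℓ : ℂ) ≠ 0 := by exact_mod_cast hℓ.ne'
  have hE2 : E ^ 2 = Complex.exp (2 * Complex.I * (ℓ : ℂ) * z) := by
    rw [hE, ← Complex.exp_nat_mul, ← Complex.exp_periodic.nat_mul n]
    congr 1
    push_cast
    field_simp
    ring
  have hsq : (E * (z - α)) ^ 2 = (z + α) ^ 2 := by
    rw [mul_pow, hE2]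
    linear_combination heq
  rcases sq_eq_sq_iff_eq_or_eq_neg.1 hsq with h | h
  · exact eq_div_of_mul_eq hne h
  · have hEim : 0 < E.im := by
      rw [hE, Complex.exp_im]
      refine mul_pos (Real.exp_pos _) (Real.sin_pos_of_pos_of_lt_pi ?_ ?_)
      · simpa [-Complex.ofReal_mul, hℓ] using hre.1
      · have := mul_lt_mul_of_pos_left hre.2 hℓ
        have h2 : ℓ * ((n + 1) * (Real.pi / ℓ)) = ℓ * (n * (Real.pi / ℓ)) + Real.pi := by
          field_simp
        simp [-Complex.ofReal_mul]
        linarith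
    have hv : E = -((z + α) / (z - α)) := by
      rw [← neg_div]
      exact eq_div_of_mul_eq hne h
    have := im_add_div_sub_pos hα him
    rw [hv, Complex.neg_im] at hEim
    linarith

theorem arccos_re_div_norm_exp_I_mul {w : ℂ} (h0 : 0 ≤ w.re) (hpi : w.re ≤ Real.pi) :
    Real.arccos ((Complex.exp (Complex.I * w)).re / ‖Complex.exp (Complex.I * w)‖) = w.re := by
  rw [Complex.norm_exp, Complex.exp_re, mul_div_cancel_left₀ _ (Real.exp_pos _).ne']
  simpa using Real.arccos_cos h0 hpi

open Filter Topology in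
/-- Along `α = γ * n * ν`, roots of the characteristic equation in the `n`-th strip satisfy
`Re z - n * ν → arccos (± 1) / ℓ`, with the sign of `(1 + γ) / (1 - γ)`. -/
theorem tendsto_re_sub_of_characteristic {ℓ γ : ℝ} (hℓ : 0 < ℓ) (hγ : 0 < γ) (hγ1 : γ ≠ 1)
    {z : ℕ → ℂ}
    (heq : ∀ᶠ n : ℕ in atTop, Complex.exp (Complex.I * (ℓ * (z n - (n * (Real.pi / ℓ) : ℝ)))) =
      (z n + (γ * n * (Real.pi / ℓ) : ℝ)) / (z n - (γ * n * (Real.pi / ℓ) : ℝ)))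
    (hre : ∀ᶠ n : ℕ in atTop, (z n).re ∈ Set.Ioo (n * (Real.pi / ℓ)) ((n + 1) * (Real.pi / ℓ)))
    (him : ∀ᶠ n : ℕ in atTop, (z n).im < 0) :
    Tendsto (fun n : ℕ => (z n).re - n * (Real.pi / ℓ)) atTop
      (𝓝 (Real.arccos ((1 + γ) / (1 - γ) / |(1 + γ) / (1 - γ)|) / ℓ)) := by
  have hν : 0 < Real.pi / ℓ := by positivity
  set ν := Real.pi / ℓ with hνdef
  have hδ : 0 < |1 - γ| := abs_pos.2 (sub_ne_zero.2 hγ1.symm)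
  have him' : ∀ᶠ n : ℕ in atTop, |(z n).im| ≤ (1 + 4 * γ / |1 - γ|) / ℓ := by
    filter_upwards [heq, hre, him, eventually_gt_atTop 0,
      tendsto_natCast_atTop_atTop.eventually_ge_atTop (2 / |1 - γ|)] with n he hr hi hpos hbig
    have hn : (0 : ℝ) < n := by exact_mod_cast hpos
    have hlow : |1 - γ| * n * ν / 2 ≤ ‖z n - (γ * n * ν : ℝ)‖ := by
      refine le_trans ?_ (Complex.abs_re_le_norm _)
      have h1 : |(1 - γ) * (n * ν)| = |1 - γ| * (n * ν) := by
        rw [abs_mul, abs_of_pos (mul_pos hn hν)]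
      have h2 : |(1 - γ) * (n * ν)| ≤ |(z n).re - γ * n * ν| + |(z n).re - n * ν| := by
        rw [show (1 - γ) * (n * ν) = ((z n).re - γ * n * ν) - ((z n).re - n * ν) by ring]
        exact abs_sub _ _
      have h3 : |(z n).re - n * ν| ≤ ν := by
        rw [abs_le]; constructor <;> nlinarith [hr.1, hr.2]
      rw [div_le_iff₀ hδ] at hbig
      simp only [Complex.sub_re, Complex.ofReal_re]
      nlinarith
    have hlow0 : 0 < |1 - γ| * n * ν / 2 := by positivity
    have hne : z n - (γ * n * ν : ℝ) ≠ 0 := norm_pos_iff.1 (hlow0.trans_le hlow)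
    have hup : ‖(z n + (γ * n * ν : ℝ)) / (z n - (γ * n * ν : ℝ))‖ ≤ 1 + 4 * γ / |1 - γ| := by
      have : (z n + (γ * n * ν : ℝ)) / (z n - (γ * n * ν : ℝ)) =
          1 + (2 * (γ * n * ν) : ℝ) / (z n - (γ * n * ν : ℝ)) := by
        field_simp
        push_cast
        ring
      rw [this]
      refine (norm_add_le _ _).trans ?_
      rw [norm_one, norm_div, Complex.norm_real, Real.norm_of_nonneg (by positivity)]
      refine add_le_add_right ?_ 1
      calc 2 * (γ * n * ν) / ‖z n - (γ * n * ν : ℝ)‖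
          ≤ 2 * (γ * n * ν) / (|1 - γ| * n * ν / 2) := by gcongr
        _ = 4 * γ / |1 - γ| := by field_simp; ring
    rw [← he, Complex.norm_exp] at hup
    have hexp := Real.add_one_le_exp (Complex.I * (ℓ * (z n - (n * ν : ℝ)))).re
    have hret : (Complex.I * (ℓ * (z n - (n * ν : ℝ)))).re = -(ℓ * (z n).im) := by
      simp [-Complex.ofReal_mul]
    rw [abs_of_neg hi, le_div_iff₀ hℓ]
    linarith
  have hlim := tendsto_div_natCast_mul_of_strip hν hre him'
  have hγ1' : (1 : ℂ) - γ ≠ 0 := by exact_mod_cast sub_ne_zero.2 hγ1.symm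
  have hv : Tendsto (fun n : ℕ => Complex.exp (Complex.I * (ℓ * (z n - (n * ν : ℝ))))) atTop
      (𝓝 (((1 + γ) / (1 - γ) : ℝ) : ℂ)) := by
    rw [Complex.ofReal_div, Complex.ofReal_add, Complex.ofReal_sub, Complex.ofReal_one]
    refine ((hlim.add_const (γ : ℂ)).div (hlim.sub_const (γ : ℂ)) hγ1').congr' ?_
    filter_upwards [heq, eventually_gt_atTop 0] with n he hpos
    have hne : ((n * ν : ℝ) : ℂ) ≠ 0 := by
      have : (0 : ℝ) < n * ν := by positivity
      exact_mod_cast this.ne'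
    rw [he, Pi.div_apply, div_add' _ _ _ hne, div_sub' hne, div_div_div_cancel_right₀ hne]
    push_cast
    ring_nf
  have hK : ‖(((1 + γ) / (1 - γ) : ℝ) : ℂ)‖ ≠ 0 := by
    rw [Complex.norm_real, norm_ne_zero_iff]
    exact div_ne_zero (by positivity) (sub_ne_zero.2 hγ1.symm)
  have hcos := (Complex.continuous_re.continuousAt.tendsto.comp hv).div hv.norm hK
  rw [Complex.ofReal_re, Complex.norm_real, Real.norm_eq_abs] at hcos
  refine (((Real.continuous_arccos.tendsto _).comp hcos).div_const ℓ).congr' ?_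
  filter_upwards [hre] with n hr
  have hw : ((ℓ : ℂ) * (z n - (n * ν : ℝ))).re = ℓ * ((z n).re - n * ν) := by
    simp [-Complex.ofReal_mul]
  have hpi : ℓ * ν = Real.pi := by rw [hνdef]; field_simp
  have := arccos_re_div_norm_exp_I_mul (w := (ℓ : ℂ) * (z n - (n * ν : ℝ)))
    (by rw [hw]; exact mul_nonneg hℓ.le (sub_nonneg.2 hr.1.le))
    (by rw [hw, ← hpi]; exact mul_le_mul_of_nonneg_left (by linarith [hr.2]) hℓ.le)
  simp only [Function.comp_apply, Pi.div_apply]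
  rw [this, hw, mul_div_cancel_left₀ _ hℓ.ne']


theorem stmt_7 (ℓ : ℝ) (hℓ : 0 < ℓ) (ν : ℝ) (hν : ν = Real.pi / ℓ)
    (θ : ℕ → ℝ → ℂ)
    (hcont : ∀ n : ℕ, ContinuousOn (θ n) (Set.Ici 0))
    (hdiff : ∀ n : ℕ, ∀ α : ℝ, 0 < α → DifferentiableAt ℝ (θ n) α)
    (h0 : ∀ n : ℕ, θ n 0 = ((n * ν : ℝ) : ℂ))
    (heq : ∀ n : ℕ, ∀ α : ℝ, 0 ≤ α →
      ((α : ℂ) - θ n α) ^ 2 * Complex.exp (2 * Complex.I * (ℓ : ℂ) * θ n α)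
        = ((α : ℂ) + θ n α) ^ 2)
    (hre : ∀ n : ℕ, ∀ α : ℝ, 0 < α →
      (θ n α).re ∈ Set.Ioo ((n : ℝ) * ν) (((n : ℝ) + 1) * ν))
    (him : ∀ n : ℕ, ∀ α : ℝ, 0 < α → (θ n α).im < 0)
    (hbd : ∀ n : ℕ, ∃ C : ℝ, 0 < C ∧ ∀ α : ℝ, 0 < α → -C ≤ (θ n α).im) :
    ∀ γ : ℝ, 0 < γ → γ ≠ 1 →
      (γ < 1 →
        Filter.Tendsto (fun n : ℕ => (θ n (γ * (n : ℝ) * ν)).re - (n : ℝ) * ν)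
          Filter.atTop (nhds 0)) ∧
      (1 < γ →
        Filter.Tendsto (fun n : ℕ => (θ n (γ * (n : ℝ) * ν)).re - (n : ℝ) * ν)
          Filter.atTop (nhds ν)) := by
  subst hν
  intro γ hγ hγ1
  have hpos : ∀ n : ℕ, 0 < n → 0 < γ * n * (Real.pi / ℓ) := fun n hn => by positivity
  have hlim := tendsto_re_sub_of_characteristic hℓ hγ hγ1
    (z := fun n => θ n (γ * n * (Real.pi / ℓ)))
    (by
      filter_upwards [Filter.eventually_gt_atTop 0] with n hn
      have hα := hpos n hn
      exact exp_I_mul_sub_eq_add_div_sub hℓ hα (heq n _ hα.le) (hre n _ hα) (him n _ hα))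
    (by
      filter_upwards [Filter.eventually_gt_atTop 0] with n hn using hre n _ (hpos n hn))
    (by
      filter_upwards [Filter.eventually_gt_atTop 0] with n hn using him n _ (hpos n hn))
  refine ⟨fun h => ?_, fun h => ?_⟩
  · have hK : 0 < (1 + γ) / (1 - γ) := div_pos (by linarith) (by linarith)
    rwa [abs_of_pos hK, div_self hK.ne', Real.arccos_one, zero_div] at hlim
  · have hK : (1 + γ) / (1 - γ) < 0 := div_neg_of_pos_of_neg (by linarith) (by linarith)
    rwa [abs_of_neg hK, div_neg, div_self hK.ne, Real.arccos_neg_one] at hlim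
end

section
/- (Proposition B.1(vi), imaginary part) For every ρ ∈ (0,1) and every s ∈ ℝ with s ≠ 0 one has −Im(θ_n(nν + s·n^ρ)) ∼ (1−ρ)·ln(n)/ℓ as n → ∞; equivalently, −ℓ·Im(θ_n(nν + s·n^ρ))/((1−ρ)·ln n) → 1 as n → ∞. (For all sufficiently large n one has nν + s·n^ρ > 0, so the expression is eventually well defined.) -/
/-- Taking moduli and square roots in the dispersion relation. -/
theorem norm_sub_mul_exp_neg_im_eq_norm_add {ℓ α : ℝ} {z : ℂ}
    (h : ((α : ℂ) - z) ^ 2 * Complex.exp (2 * Complex.I * (ℓ : ℂ) * z) = ((α : ℂ) + z) ^ 2) :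
    ‖(α : ℂ) - z‖ * Real.exp (-ℓ * z.im) = ‖(α : ℂ) + z‖ := by
  have h1 := congrArg norm h
  rw [norm_mul, norm_pow, norm_pow, Complex.norm_exp] at h1
  have h2 : (2 * Complex.I * (ℓ : ℂ) * z).re = -ℓ * z.im + -ℓ * z.im := by
    simp
    ring
  rw [h2, Real.exp_add] at h1
  refine (sq_eq_sq₀ (by positivity) (by positivity)).mp ?_
  rw [← h1]
  ring

/-- If `Re z` is within `w` of `N` and `α = N + δ` with `w ≪ |δ| ≪ N`, then `exp (-ℓ Im z)` is at
most a constant times `N / |δ|`. -/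
theorem exp_neg_im_le {ℓ N δ w : ℝ} {z : ℂ}
    (hre₁ : N ≤ z.re) (hre₂ : z.re ≤ N + w) (him : z.im < 0)
    (h : ‖((N + δ : ℝ) : ℂ) - z‖ * Real.exp (-ℓ * z.im) = ‖((N + δ : ℝ) : ℂ) + z‖)
    (hw : 2 * w ≤ |δ|) (hδℓ : 4 ≤ |δ| * ℓ) (hδN : 2 * |δ| ≤ N) :
    |δ| * Real.exp (-ℓ * z.im) ≤ 16 * N := by
  have hlow : |δ| / 2 ≤ ‖((N + δ : ℝ) : ℂ) - z‖ := by
    refine le_trans ?_ (Complex.abs_re_le_norm _)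
    simp only [Complex.sub_re, Complex.ofReal_re]
    cases abs_cases δ <;> cases abs_cases (N + δ - z.re) <;> linarith
  have hup : ‖((N + δ : ℝ) : ℂ) + z‖ ≤ 4 * N + -z.im := by
    refine (Complex.norm_le_abs_re_add_abs_im _).trans ?_
    simp only [Complex.add_re, Complex.add_im, Complex.ofReal_re, Complex.ofReal_im, zero_add,
      abs_of_neg him]
    cases abs_cases δ <;> cases abs_cases (N + δ + z.re) <;> linarith
  have hexp : -ℓ * z.im ≤ Real.exp (-ℓ * z.im) := by
    linarith [Real.add_one_le_exp (-ℓ * z.im)]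
  have h1 := mul_le_mul_of_nonneg_right hlow (Real.exp_pos (-ℓ * z.im)).le
  have h2 := mul_le_mul_of_nonneg_left hexp (abs_nonneg δ)
  nlinarith

/-- The lower bound matching `exp_neg_im_le`, once `-Im z` is known to be small. -/
theorem le_norm_sub_mul_exp_neg_im {ℓ N δ w p : ℝ} {z : ℂ}
    (hre₁ : N ≤ z.re) (hre₂ : z.re ≤ N + w) (him : z.im < 0)
    (h : ‖((N + δ : ℝ) : ℂ) - z‖ * Real.exp (-ℓ * z.im) = ‖((N + δ : ℝ) : ℂ) + z‖)
    (hw : 2 * w ≤ |δ|) (hδN : 2 * |δ| ≤ N) (hp : -z.im ≤ p) :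
    N ≤ (2 * |δ| + p) * Real.exp (-ℓ * z.im) := by
  have hup : ‖((N + δ : ℝ) : ℂ) - z‖ ≤ 2 * |δ| + p := by
    refine (Complex.norm_le_abs_re_add_abs_im _).trans ?_
    simp only [Complex.sub_re, Complex.sub_im, Complex.ofReal_re, Complex.ofReal_im, zero_sub,
      abs_neg, abs_of_neg him]
    cases abs_cases δ <;> cases abs_cases (N + δ - z.re) <;> linarith
  have hlow : N ≤ ‖((N + δ : ℝ) : ℂ) + z‖ := by
    refine le_trans ?_ (Complex.re_le_norm _)
    simp only [Complex.add_re, Complex.ofReal_re]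
    cases abs_cases δ <;> linarith
  calc N ≤ _ := hlow
    _ = _ := h.symm
    _ ≤ _ := mul_le_mul_of_nonneg_right hup (Real.exp_pos _).le

/-- A sequence within bounded distance of `c * log n` is asymptotic to it. -/
theorem tendsto_div_mul_log_of_bounded_sub {f : ℕ → ℝ} {c A B : ℝ} (hc : 0 < c)
    (hA : ∀ᶠ n : ℕ in Filter.atTop, A + c * Real.log n ≤ f n)
    (hB : ∀ᶠ n : ℕ in Filter.atTop, f n ≤ B + c * Real.log n) :
    Filter.Tendsto (fun n : ℕ => f n / (c * Real.log n)) Filter.atTop (nhds 1) := by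
  have hlog : Filter.Tendsto (fun n : ℕ => c * Real.log n) Filter.atTop Filter.atTop :=
    (Real.tendsto_log_atTop.comp tendsto_natCast_atTop_atTop).const_mul_atTop hc
  have hlim (K : ℝ) : Filter.Tendsto (fun n : ℕ => K / (c * Real.log n) + 1) Filter.atTop
      (nhds 1) := by
    simpa using (hlog.const_div_atTop K).add_const 1
  refine tendsto_of_tendsto_of_tendsto_of_le_of_le' (hlim A) (hlim B) ?_ ?_
  · filter_upwards [hA, hlog.eventually_gt_atTop 0] with n hn hpos
    rwa [le_div_iff₀ hpos, add_mul, div_mul_cancel₀ _ hpos.ne', one_mul]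
  · filter_upwards [hB, hlog.eventually_gt_atTop 0] with n hn hpos
    rwa [div_le_iff₀ hpos, add_mul, div_mul_cancel₀ _ hpos.ne', one_mul]


theorem stmt_8 (ℓ : ℝ) (hℓ : 0 < ℓ) (ν : ℝ) (hν : ν = Real.pi / ℓ)
    (θ : ℕ → ℝ → ℂ)
    (hcont : ∀ n : ℕ, ContinuousOn (θ n) (Set.Ici 0))
    (hdiff : ∀ n : ℕ, ∀ α : ℝ, 0 < α → DifferentiableAt ℝ (θ n) α)
    (h0 : ∀ n : ℕ, θ n 0 = ((n * ν : ℝ) : ℂ))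
    (heq : ∀ n : ℕ, ∀ α : ℝ, 0 ≤ α →
      ((α : ℂ) - θ n α) ^ 2 * Complex.exp (2 * Complex.I * (ℓ : ℂ) * θ n α)
        = ((α : ℂ) + θ n α) ^ 2)
    (hre : ∀ n : ℕ, ∀ α : ℝ, 0 < α →
      (θ n α).re ∈ Set.Ioo ((n : ℝ) * ν) (((n : ℝ) + 1) * ν))
    (him : ∀ n : ℕ, ∀ α : ℝ, 0 < α → (θ n α).im < 0)
    (hbd : ∀ n : ℕ, ∃ C : ℝ, 0 < C ∧ ∀ α : ℝ, 0 < α → -C ≤ (θ n α).im) :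
    ∀ ρ : ℝ, ρ ∈ Set.Ioo (0 : ℝ) 1 → ∀ s : ℝ, s ≠ 0 →
      Filter.Tendsto
        (fun n : ℕ =>
          -ℓ * (θ n ((n : ℝ) * ν + s * (n : ℝ) ^ ρ)).im / ((1 - ρ) * Real.log n))
        Filter.atTop (nhds 1) := by
  rintro ρ ⟨hρ0, hρ1⟩ s hs
  have hν0 : 0 < ν := hν ▸ div_pos Real.pi_pos hℓ
  have hs0 : 0 < |s| := abs_pos.mpr hs
  have hpow : Filter.Tendsto (fun n : ℕ => (n : ℝ) ^ ρ) Filter.atTop Filter.atTop :=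
    (tendsto_rpow_atTop hρ0).comp tendsto_natCast_atTop_atTop
  have hsmall : ∀ᶠ n : ℕ in Filter.atTop, 2 * (|s| * (n : ℝ) ^ ρ) ≤ n * ν := by
    have hpow' : Filter.Tendsto (fun n : ℕ => (n : ℝ) ^ (1 - ρ)) Filter.atTop Filter.atTop :=
      (tendsto_rpow_atTop (sub_pos.mpr hρ1)).comp tendsto_natCast_atTop_atTop
    filter_upwards [hpow'.eventually_ge_atTop (2 * |s| / ν), Filter.eventually_gt_atTop 0]
      with n hn hn0
    have hn' : (0 : ℝ) < n := Nat.cast_pos.mpr hn0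
    have hmul : (n : ℝ) ^ (1 - ρ) * (n : ℝ) ^ ρ = n := by
      rw [← Real.rpow_add hn', sub_add_cancel, Real.rpow_one]
    rw [div_le_iff₀ hν0] at hn
    have := mul_le_mul_of_nonneg_right hn (Real.rpow_nonneg hn'.le ρ)
    rw [mul_right_comm _ ν, hmul] at this
    linarith
  have hlogpow (B : ℝ) : ∀ᶠ n : ℕ in Filter.atTop,
      B + (1 - ρ) * Real.log n ≤ ℓ * (n : ℝ) ^ ρ := by
    have h := ((isLittleO_log_rpow_atTop hρ0).comp_tendsto
      tendsto_natCast_atTop_atTop).bound (c := ℓ / 2) (by positivity)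
    filter_upwards [h, hpow.eventually_ge_atTop (2 * B / ℓ), Filter.eventually_ge_atTop 1]
      with n hn hB h1
    have hlog : 0 ≤ Real.log n := Real.log_natCast_nonneg n
    simp only [Function.comp, Real.norm_eq_abs, abs_of_nonneg hlog,
      abs_of_nonneg (Real.rpow_nonneg (Nat.cast_nonneg n) ρ)] at hn
    rw [div_le_iff₀ hℓ] at hB
    nlinarith
  have hquot {n : ℕ} (hn : 0 < n) {K : ℝ} (hK : 0 < K) :
      Real.log (K * (n / (n : ℝ) ^ ρ)) = Real.log K + (1 - ρ) * Real.log n := by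
    have hn' : (0 : ℝ) < n := Nat.cast_pos.mpr hn
    have hp := Real.rpow_pos_of_pos hn' ρ
    rw [Real.log_mul hK.ne' (by positivity), Real.log_div hn'.ne' hp.ne', Real.log_rpow hn']
    ring
  have hbasic : ∀ᶠ n : ℕ in Filter.atTop, 0 < n ∧ 2 * ν ≤ |s * (n : ℝ) ^ ρ| ∧
      4 ≤ |s * (n : ℝ) ^ ρ| * ℓ ∧ 2 * |s * (n : ℝ) ^ ρ| ≤ n * ν ∧
      0 < n * ν + s * (n : ℝ) ^ ρ := by
    filter_upwards [hsmall, hpow.eventually_ge_atTop (2 * ν / |s|),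
      hpow.eventually_ge_atTop (4 / (|s| * ℓ)), Filter.eventually_gt_atTop 0] with n h1 h2 h3 hn
    have hn' : (0 : ℝ) < n := Nat.cast_pos.mpr hn
    rw [div_le_iff₀ (by positivity)] at h2 h3
    have habs : |s * (n : ℝ) ^ ρ| = |s| * (n : ℝ) ^ ρ := by
      rw [abs_mul, abs_of_nonneg (Real.rpow_nonneg hn'.le ρ)]
    have hneg := neg_abs_le (s * (n : ℝ) ^ ρ)
    have hnν : 0 < n * ν := by positivity
    rw [← habs] at h1
    refine ⟨hn, ?_, ?_, h1, by linarith⟩ <;> rw [habs] <;> linarith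
  have hupper : ∀ᶠ n : ℕ in Filter.atTop,
      -ℓ * (θ n ((n : ℝ) * ν + s * (n : ℝ) ^ ρ)).im ≤
        Real.log (16 * ν / |s|) + (1 - ρ) * Real.log n := by
    filter_upwards [hbasic] with n ⟨hn, h1, h2, h3, h4⟩
    have hp : 0 < (n : ℝ) ^ ρ := Real.rpow_pos_of_pos (Nat.cast_pos.mpr hn) ρ
    have hr := hre n _ h4
    have key := exp_neg_im_le hr.1.le (by linarith [hr.2]) (him n _ h4)
      (norm_sub_mul_exp_neg_im_eq_norm_add (heq n _ h4.le)) h1 h2 h3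
    rw [abs_mul, abs_of_pos hp] at key
    rw [← hquot hn (by positivity), Real.le_log_iff_exp_le (by positivity), div_mul_div_comm,
      le_div_iff₀ (by positivity)]
    linarith
  have hlower : ∀ᶠ n : ℕ in Filter.atTop,
      Real.log (ν / (2 * |s| + 1)) + (1 - ρ) * Real.log n ≤
        -ℓ * (θ n ((n : ℝ) * ν + s * (n : ℝ) ^ ρ)).im := by
    filter_upwards [hbasic, hupper, hlogpow (Real.log (16 * ν / |s|))]
      with n ⟨hn, h1, h2, h3, h4⟩ hup hlp
    have hp : 0 < (n : ℝ) ^ ρ := Real.rpow_pos_of_pos (Nat.cast_pos.mpr hn) ρ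
    have hr := hre n _ h4
    have him_le : -(θ n ((n : ℝ) * ν + s * (n : ℝ) ^ ρ)).im ≤ (n : ℝ) ^ ρ :=
      le_of_mul_le_mul_left (by linarith) hℓ
    have key := le_norm_sub_mul_exp_neg_im hr.1.le (by linarith [hr.2]) (him n _ h4)
      (norm_sub_mul_exp_neg_im_eq_norm_add (heq n _ h4.le)) h1 h3 him_le
    rw [abs_mul, abs_of_pos hp] at key
    have hn' : (0 : ℝ) < n := Nat.cast_pos.mpr hn
    rw [← hquot hn (by positivity), Real.log_le_iff_le_exp (by positivity), div_mul_div_comm,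
      div_le_iff₀ (by positivity)]
    linarith
  exact tendsto_div_mul_log_of_bounded_sub (by linarith) hlower hupper
end

section
/- (Proposition B.1(vi), real part) For every ρ ∈ (0,1) and every s ∈ ℝ with s ≠ 0: if s < 0 then Re(θ_n(nν + s·n^ρ)) − nν → 0 as n → ∞, and if s > 0 then Re(θ_n(nν + s·n^ρ)) − nν → ν as n → ∞. (For all sufficiently large n one has nν + s·n^ρ > 0, so the expression is eventually well defined.) -/
/-- The square root of the dispersion relation, with the sign fixed by continuity from `α = 0`. -/
lemma sub_mul_exp_eq_add_of_sq {ℓ a : ℝ} (ha : 0 < a) {θ : ℝ → ℂ}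
    (hcont : ContinuousOn θ (Set.Ici 0)) (h0 : θ 0 = a)
    (hexp : Complex.exp (2 * Complex.I * ℓ * a) = 1)
    (heq : ∀ α : ℝ, 0 ≤ α →
      ((α : ℂ) - θ α) ^ 2 * Complex.exp (2 * Complex.I * ℓ * θ α) = ((α : ℂ) + θ α) ^ 2)
    (hre : ∀ α : ℝ, 0 < α → 0 < (θ α).re) {α : ℝ} (hα : 0 ≤ α) :
    (θ α - α) * Complex.exp (Complex.I * ℓ * (θ α - a)) = θ α + α := by
  have hpos : ∀ β : ℝ, 0 ≤ β → 0 < (θ β).re := by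
    intro β hβ
    rcases hβ.eq_or_lt with rfl | hβ
    · simpa [h0] using ha
    · exact hre β hβ
  have hc : ContinuousOn (fun β : ℝ => (β : ℂ)) (Set.Ici 0) :=
    Complex.continuous_ofReal.continuousOn
  refine (isPreconnected_Ici (a := (0 : ℝ))).eq_of_sq_eq
    (f := fun β : ℝ => (θ β - β) * Complex.exp (Complex.I * ℓ * (θ β - a)))
    (g := fun β : ℝ => θ β + β) ?_ (hcont.add hc) ?_ ?_ (y := 0) Set.self_mem_Ici ?_ hα
  · exact (hcont.sub hc).mul
      (Complex.continuous_exp.comp_continuousOn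
        (continuousOn_const.mul (hcont.sub continuousOn_const)))
  · intro β hβ
    have hsplit : Complex.exp (Complex.I * ℓ * (θ β - a)) ^ 2
        = Complex.exp (2 * Complex.I * ℓ * θ β) := by
      rw [← Complex.exp_nat_mul, ← mul_one (Complex.exp (_ * _)), ← hexp, ← Complex.exp_add]
      congr 1
      push_cast
      ring
    have h := heq β hβ
    simp only [Pi.pow_apply, mul_pow, hsplit]
    linear_combination h
  · intro β hβ h
    have h' := congrArg Complex.re h
    simp only [Complex.add_re, Complex.ofReal_re, Complex.zero_re] at h'
    have := hpos β hβ
    have : (0 : ℝ) ≤ β := hβ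
    linarith
  · simp [h0]

lemma abs_im_le_one_add_log {ℓ ν N δ : ℝ} (hℓ : 0 < ℓ) (hν : 0 < ν) (hN : 0 ≤ N) {z : ℂ}
    (hz : z.re ∈ Set.Ioo 0 ν) (hzi : z.im < 0)
    (h : (z - δ) * Complex.exp (Complex.I * ℓ * z) = 2 * N * ν + z + δ) :
    |z.im| ≤ 1 + Real.log (1 + (2 * N * ν + ν + |δ|)) / ℓ := by
  have hK : 0 ≤ 2 * N * ν + ν + |δ| := by positivity
  by_cases hy : |z.im| ≤ 1
  · have : 0 ≤ Real.log (1 + (2 * N * ν + ν + |δ|)) / ℓ :=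
      div_nonneg (Real.log_nonneg (by linarith)) hℓ.le
    linarith
  push Not at hy
  have hnorm : ‖Complex.exp (Complex.I * ℓ * z)‖ = Real.exp (ℓ * |z.im|) := by
    rw [Complex.norm_exp, abs_of_neg hzi]
    simp
  have hl : |z.im| ≤ ‖z - δ‖ := by
    simpa using Complex.abs_im_le_norm (z - δ)
  have hr : ‖2 * N * ν + z + δ‖ ≤ 2 * N * ν + ν + |δ| + |z.im| := by
    have h1 : ‖(2 * N * ν : ℂ)‖ = 2 * N * ν := by
      simp [abs_of_nonneg hN, abs_of_pos hν]
    have h2 : ‖z‖ ≤ ν + |z.im| :=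
      (Complex.norm_le_abs_re_add_abs_im z).trans
        (by rw [abs_of_pos hz.1]; linarith [hz.2])
    have h3 : ‖(δ : ℂ)‖ = |δ| := by simp
    linarith [norm_add₃_le (a := (2 * N * ν : ℂ)) (b := z) (c := (δ : ℂ))]
  have hmul : |z.im| * Real.exp (ℓ * |z.im|) ≤ 2 * N * ν + ν + |δ| + |z.im| := by
    calc |z.im| * Real.exp (ℓ * |z.im|)
        ≤ ‖z - δ‖ * ‖Complex.exp (Complex.I * ℓ * z)‖ := by rw [hnorm]; gcongr
      _ = ‖2 * N * ν + z + δ‖ := by rw [← norm_mul, h]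
      _ ≤ _ := hr
  have hexp : Real.exp (ℓ * |z.im|) ≤ 1 + (2 * N * ν + ν + |δ|) := by
    by_contra! hlt
    nlinarith
  have hlog := (Real.le_log_iff_exp_le (by linarith)).2 hexp
  have : |z.im| ≤ Real.log (1 + (2 * N * ν + ν + |δ|)) / ℓ := by
    rw [le_div_iff₀ hℓ]; linarith
  linarith

open Filter Topology in
lemma tendsto_cos_re_of_sub_mul_exp_eq {ℓ ν ρ s : ℝ} (hℓ : 0 < ℓ) (hν : 0 < ν)
    (hρ : ρ ∈ Set.Ioo (0 : ℝ) 1) (hs : s ≠ 0) {z : ℕ → ℂ}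
    (hz : ∀ᶠ n in atTop, (z n).re ∈ Set.Ioo 0 ν) (hzi : ∀ᶠ n in atTop, (z n).im < 0)
    (h : ∀ᶠ n : ℕ in atTop, (z n - (s * (n : ℝ) ^ ρ : ℝ)) * Complex.exp (Complex.I * ℓ * z n)
      = 2 * (n : ℝ) * ν + z n + (s * (n : ℝ) ^ ρ : ℝ)) :
    Tendsto (fun n => Real.cos (ℓ * (z n).re)) atTop (𝓝 (-s / |s|)) := by
  have hρ0 : 0 < ρ := hρ.1
  have hnρ : Tendsto (fun n : ℕ => (n : ℝ) ^ ρ) atTop atTop :=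
    (tendsto_rpow_atTop hρ0).comp tendsto_natCast_atTop_atTop
  have hratio : Tendsto (fun n : ℕ => (n : ℝ) ^ ρ / n) atTop (𝓝 0) := by
    refine ((tendsto_rpow_neg_atTop (sub_pos.2 hρ.2)).comp
      tendsto_natCast_atTop_atTop).congr' ?_
    filter_upwards [eventually_gt_atTop 0] with n hn
    have : (0 : ℝ) < n := by exact_mod_cast hn
    simp only [Function.comp_apply, neg_sub]
    rw [Real.rpow_sub_one this.ne']
  have hlog : Tendsto (fun n : ℕ => Real.log n / (n : ℝ) ^ ρ) atTop (𝓝 0) :=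
    ((isLittleO_log_rpow_atTop hρ0).tendsto_div_nhds_zero).comp tendsto_natCast_atTop_atTop
  set K : ℝ := 1 + 3 * ν + |s| with hK
  have hK1 : 0 < K := by positivity
  have hzsmall : Tendsto (fun n : ℕ => z n / ((n : ℝ) ^ ρ : ℝ)) atTop (𝓝 0) := by
    have hb : Tendsto (fun n : ℕ => (ν + 1 + Real.log K / ℓ) / (n : ℝ) ^ ρ
        + Real.log n / (n : ℝ) ^ ρ / ℓ) atTop (𝓝 0) := by
      simpa using (hnρ.const_div_atTop (ν + 1 + Real.log K / ℓ)).add (hlog.div_const ℓ)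
    refine squeeze_zero_norm' ?_ hb
    filter_upwards [hz, hzi, h, eventually_ge_atTop 1] with n hz hzi h hn
    have hn1 : (1 : ℝ) ≤ n := by exact_mod_cast hn
    have hp : 0 < (n : ℝ) ^ ρ := by positivity
    have hpn : (n : ℝ) ^ ρ ≤ n := by
      simpa using Real.rpow_le_rpow_of_exponent_le hn1 hρ.2.le
    have him := abs_im_le_one_add_log hℓ hν (by positivity : (0 : ℝ) ≤ n) hz hzi h
    have harg : 1 + (2 * n * ν + ν + |s * (n : ℝ) ^ ρ|) ≤ K * n := by
      rw [abs_mul, abs_of_pos hp, hK]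
      nlinarith [mul_le_mul_of_nonneg_left hpn (abs_nonneg s)]
    have hl : Real.log (1 + (2 * n * ν + ν + |s * (n : ℝ) ^ ρ|)) ≤ Real.log K + Real.log n := by
      rw [← Real.log_mul hK1.ne' (by positivity)]
      exact Real.log_le_log (by positivity) harg
    have hl' := div_le_div_of_nonneg_right hl hℓ.le
    rw [add_div] at hl'
    have hzn : ‖z n‖ ≤ ν + 1 + Real.log K / ℓ + Real.log n / ℓ := by
      have := Complex.norm_le_abs_re_add_abs_im (z n)
      rw [abs_of_pos hz.1] at this
      linarith [hz.2]
    rw [norm_div, Complex.norm_real, Real.norm_of_nonneg hp.le, div_right_comm, ← add_div]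
    gcongr
  have hratioC : Tendsto (fun n : ℕ => (((n : ℝ) ^ ρ / n : ℝ) : ℂ)) atTop (𝓝 0) := by
    rw [← Complex.ofReal_zero]
    exact (Complex.continuous_ofReal.tendsto 0).comp hratio
  have hlim : Tendsto (fun n : ℕ => Complex.exp (Complex.I * ℓ * z n)
      * ((n : ℝ) ^ ρ / n : ℝ)) atTop (𝓝 ((-(2 * ν / s) : ℝ) : ℂ)) := by
    have hden : Tendsto (fun n : ℕ => z n / ((n : ℝ) ^ ρ : ℝ) - (s : ℂ)) atTop
        (𝓝 (0 - (s : ℂ))) := hzsmall.sub_const _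
    have hnum : Tendsto (fun n : ℕ => 2 * (ν : ℂ)
        + (z n / ((n : ℝ) ^ ρ : ℝ) + s) * ((n : ℝ) ^ ρ / n : ℝ)) atTop
        (𝓝 (2 * (ν : ℂ) + (0 + s) * 0)) :=
      ((hzsmall.add_const _).mul hratioC).const_add _
    have hs' : (0 - (s : ℂ)) ≠ 0 := by simpa using hs
    have hq := hnum.div hden hs'
    have hval : (2 * (ν : ℂ) + (0 + s) * 0) / (0 - s) = ((-(2 * ν / s) : ℝ) : ℂ) := by
      push_cast
      rw [zero_sub, div_neg]
      simp
    rw [hval] at hq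
    refine hq.congr' ?_
    filter_upwards [h, eventually_ge_atTop 1, hden.eventually_ne hs'] with n h hn hne
    have hn0 : (n : ℂ) ≠ 0 := by exact_mod_cast (by omega : n ≠ 0)
    have hp : (((n : ℝ) ^ ρ : ℝ) : ℂ) ≠ 0 := by
      have : 0 < (n : ℝ) ^ ρ := Real.rpow_pos_of_pos (by exact_mod_cast hn) _
      exact_mod_cast this.ne'
    simp only [Pi.div_apply]
    rw [div_eq_iff hne, Complex.ofReal_div, Complex.ofReal_natCast]
    rw [Complex.ofReal_mul, Complex.ofReal_natCast] at h
    generalize Complex.exp (Complex.I * ℓ * z n) = w at h ⊢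
    field_simp
    linear_combination -h
  have hL : ‖((-(2 * ν / s) : ℝ) : ℂ)‖ ≠ 0 := by
    simp [hν.ne', hs]
  have hcos := ((Complex.continuous_re.tendsto _).comp hlim).div hlim.norm hL
  have hval : (((-(2 * ν / s) : ℝ) : ℂ)).re / ‖((-(2 * ν / s) : ℝ) : ℂ)‖ = -s / |s| := by
    rw [Complex.ofReal_re, Complex.norm_real, Real.norm_eq_abs, abs_neg, abs_div,
      abs_of_pos (by positivity : 0 < 2 * ν)]
    have : |s| ≠ 0 := by simpa using hs
    field_simp
    rw [sq_abs]
  rw [hval] at hcos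
  refine hcos.congr' ?_
  filter_upwards [eventually_ge_atTop 1] with n hn
  have hr : 0 < (n : ℝ) ^ ρ / n := by
    have : (0 : ℝ) < n := by exact_mod_cast hn
    positivity
  simp only [Pi.div_apply, Function.comp_apply]
  rw [Complex.re_mul_ofReal, norm_mul, Complex.norm_real, Real.norm_of_nonneg hr.le,
    mul_div_mul_right _ _ hr.ne', Complex.norm_exp, Complex.exp_re,
    mul_div_cancel_left₀ _ (Real.exp_ne_zero _)]
  simp


theorem stmt_9 (ℓ : ℝ) (hℓ : 0 < ℓ) (ν : ℝ) (hν : ν = Real.pi / ℓ)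
    (θ : ℕ → ℝ → ℂ)
    (hcont : ∀ n : ℕ, ContinuousOn (θ n) (Set.Ici 0))
    (hdiff : ∀ n : ℕ, ∀ α : ℝ, 0 < α → DifferentiableAt ℝ (θ n) α)
    (h0 : ∀ n : ℕ, θ n 0 = ((n * ν : ℝ) : ℂ))
    (heq : ∀ n : ℕ, ∀ α : ℝ, 0 ≤ α →
      ((α : ℂ) - θ n α) ^ 2 * Complex.exp (2 * Complex.I * (ℓ : ℂ) * θ n α)
        = ((α : ℂ) + θ n α) ^ 2)
    (hre : ∀ n : ℕ, ∀ α : ℝ, 0 < α →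
      (θ n α).re ∈ Set.Ioo ((n : ℝ) * ν) (((n : ℝ) + 1) * ν))
    (him : ∀ n : ℕ, ∀ α : ℝ, 0 < α → (θ n α).im < 0)
    (hbd : ∀ n : ℕ, ∃ C : ℝ, 0 < C ∧ ∀ α : ℝ, 0 < α → -C ≤ (θ n α).im) :
    ∀ ρ : ℝ, ρ ∈ Set.Ioo (0 : ℝ) 1 → ∀ s : ℝ, s ≠ 0 →
      (s < 0 →
        Filter.Tendsto
          (fun n : ℕ => (θ n ((n : ℝ) * ν + s * (n : ℝ) ^ ρ)).re - (n : ℝ) * ν)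
          Filter.atTop (nhds 0)) ∧
      (0 < s →
        Filter.Tendsto
          (fun n : ℕ => (θ n ((n : ℝ) * ν + s * (n : ℝ) ^ ρ)).re - (n : ℝ) * ν)
          Filter.atTop (nhds ν)) := by
  intro ρ hρ s hs
  have hνpos : 0 < ν := hν ▸ div_pos Real.pi_pos hℓ
  have hℓν : ℓ * ν = Real.pi := by rw [hν]; field_simp
  have hpos : ∀ᶠ n : ℕ in Filter.atTop, 0 < (n : ℝ) * ν + s * (n : ℝ) ^ ρ := by
    have hlittle : Filter.Tendsto (fun n : ℕ => ν + s * (n : ℝ) ^ (ρ - 1)) Filter.atTop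
        (nhds (ν + s * 0)) := by
      have := (tendsto_rpow_neg_atTop (sub_pos.2 hρ.2)).comp
        (tendsto_natCast_atTop_atTop (R := ℝ))
      simp only [neg_sub] at this
      exact (this.const_mul s).const_add ν
    filter_upwards [hlittle.eventually_const_lt (by simpa using hνpos),
      Filter.eventually_gt_atTop 0] with n hn hn0
    have hn0 : (0 : ℝ) < n := by exact_mod_cast hn0
    rw [Real.rpow_sub_one hn0.ne'] at hn
    have := mul_pos hn0 hn
    field_simp at this
    linarith
  set z : ℕ → ℂ := fun n => θ n (n * ν + s * (n : ℝ) ^ ρ) - ((n * ν : ℝ) : ℂ) with hzdef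
  have hzre : ∀ n, (z n).re = (θ n (n * ν + s * (n : ℝ) ^ ρ)).re - n * ν := by
    intro n
    simp only [hzdef, Complex.sub_re, Complex.ofReal_re]
  have hz : ∀ᶠ n in Filter.atTop, (z n).re ∈ Set.Ioo 0 ν := by
    filter_upwards [hpos] with n hn
    rw [hzre]
    have := hre n _ hn
    constructor <;> linarith [this.1, this.2]
  have hzi : ∀ᶠ n in Filter.atTop, (z n).im < 0 := by
    filter_upwards [hpos] with n hn
    simpa only [hzdef, Complex.sub_im, Complex.ofReal_im, sub_zero] using him n _ hn
  have hsq : ∀ᶠ n : ℕ in Filter.atTop,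
      (z n - (s * (n : ℝ) ^ ρ : ℝ)) * Complex.exp (Complex.I * ℓ * z n)
        = 2 * (n : ℝ) * ν + z n + (s * (n : ℝ) ^ ρ : ℝ) := by
    filter_upwards [hpos, Filter.eventually_gt_atTop 0] with n hn hn0
    have ha : 0 < (n : ℝ) * ν := mul_pos (by exact_mod_cast hn0) hνpos
    have hexp : Complex.exp (2 * Complex.I * ℓ * ((n * ν : ℝ) : ℂ)) = 1 := by
      rw [Complex.exp_eq_one_iff]
      refine ⟨n, ?_⟩
      rw [← hℓν]
      push_cast
      ring
    have key := sub_mul_exp_eq_add_of_sq ha (hcont n) (h0 n) hexp (heq n)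
      (fun β hβ => ha.trans (hre n β hβ).1) hn.le
    rw [Complex.ofReal_add] at key
    rw [hzdef]
    convert key using 1 <;> push_cast <;> ring_nf
  have hcos := tendsto_cos_re_of_sub_mul_exp_eq hℓ hνpos hρ hs hz hzi hsq
  have harc : Filter.Tendsto (fun n => (z n).re) Filter.atTop
      (nhds (Real.arccos (-s / |s|) / ℓ)) := by
    refine (((Real.continuous_arccos.tendsto _).comp hcos).div_const ℓ).congr' ?_
    filter_upwards [hz] with n hn
    have h1 : ℓ * (z n).re ≤ Real.pi := hℓν ▸ mul_le_mul_of_nonneg_left hn.2.le hℓ.le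
    simp only [Function.comp_apply]
    rw [Real.arccos_cos (mul_pos hℓ hn.1).le h1, mul_div_cancel_left₀ _ hℓ.ne']
  simp only [hzre] at harc
  constructor
  · intro hneg
    rwa [abs_of_neg hneg, div_self (neg_ne_zero.2 hs), Real.arccos_one, zero_div] at harc
  · intro hpos
    rwa [abs_of_pos hpos, neg_div, div_self hs, Real.arccos_neg_one, ← hν] at harc
end

section
/- (Lemma 3.3, Hardy-type inequality on a wave guide) Let δ > 1/2 and σ < δ − 1. Then there exists C ≥ 0 such that for every smooth compactly supported function u : ℝ^d × ℝ^n → ℂ one has (∫_Ω ⟨x⟩^{2σ} |u(x,y)|² dx dy)^{1/2} ≤ C · (∫_Ω ⟨x⟩^{2δ} |∇u(x,y)|² dx dy)^{1/2}. -/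
open MeasureTheory

section Slices

variable {E F : Type*} [NormedAddCommGroup E] [NormedSpace ℝ E]
  [NormedAddCommGroup F] [NormedSpace ℝ F]

lemma integrable_fderiv_apply [MeasurableSpace E] [OpensMeasurableSpace E]
    {μ : Measure E} [IsFiniteMeasureOnCompacts μ] {f : E → ℝ}
    (hf : ContDiff ℝ 1 f) (hs : HasCompactSupport f) (v : E) :
    Integrable (fun x => fderiv ℝ f x v) μ :=
  ((hf.continuous_fderiv one_ne_zero).clm_apply
    continuous_const).integrable_of_hasCompactSupport (hs.fderiv_apply ℝ v)

variable [FiniteDimensional ℝ E]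

/-- A compactly supported `C¹` function has directional derivatives of zero mean. -/
lemma integral_fderiv_apply_eq_zero [MeasurableSpace E] [BorelSpace E]
    (μ : Measure E) [μ.IsAddHaarMeasure] {f : E → ℝ} (hf : ContDiff ℝ 1 f)
    (hs : HasCompactSupport f) (v : E) : ∫ x, fderiv ℝ f x v ∂μ = 0 := by
  have h := integral_mul_fderiv_eq_neg_fderiv_mul_of_integrable (μ := μ) (f := f)
    (g := fun _ => (1 : ℝ)) (v := v)
    (by simpa using integrable_fderiv_apply hf hs v)
    (by simp)
    (by simpa using hf.continuous.integrable_of_hasCompactSupport hs)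
    (fun x _ => hf.differentiable one_ne_zero x) (fun x _ => by fun_prop)
  simpa using h

/-- Derivatives along the unbounded directions integrate to zero over a cylinder. -/
lemma setIntegral_univ_prod_fderiv_apply_eq_zero [MeasurableSpace E] [BorelSpace E]
    [FiniteDimensional ℝ F] [MeasurableSpace F] [BorelSpace F]
    (μ : Measure E) [μ.IsAddHaarMeasure] (ν : Measure F) [ν.IsAddHaarMeasure]
    {f : E × F → ℝ} (hf : ContDiff ℝ 1 f) (hs : HasCompactSupport f) (s : Set F) (v : E) :
    ∫ p in Set.univ ×ˢ s, fderiv ℝ f p (v, 0) ∂(μ.prod ν) = 0 := by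
  have hint : Integrable (fun p => fderiv ℝ f p (v, 0)) (μ.prod ν) :=
    integrable_fderiv_apply hf hs (v, 0)
  have hr : (μ.prod ν).restrict (Set.univ ×ˢ s) = μ.prod (ν.restrict s) := by
    rw [← Measure.prod_restrict, Measure.restrict_univ]
  rw [hr, integral_prod_symm _ (by rw [← hr]; exact hint.restrict)]
  refine integral_eq_zero_of_ae (Filter.Eventually.of_forall fun y => ?_)
  rw [Pi.zero_apply]
  have hslice (x : E) :
      fderiv ℝ (fun x => f (x, y)) x v = fderiv ℝ f (x, y) (v, 0) := by
    have h1 : HasFDerivAt (fun x : E => (x, y)) (ContinuousLinearMap.inl ℝ E F) x :=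
      hasFDerivAt_prodMk_left x y
    have h2 := (hf.differentiable one_ne_zero (x, y)).hasFDerivAt.comp x h1
    rw [show (fun x => f (x, y)) = f ∘ fun x => (x, y) from rfl, h2.fderiv]
    simp
  have hcs : HasCompactSupport (fun x => f (x, y)) :=
    HasCompactSupport.intro (hs.isCompact.image continuous_fst) fun x hx =>
      image_eq_zero_of_notMem_tsupport fun h => hx ⟨(x, y), h, rfl⟩
  have h0 := integral_fderiv_apply_eq_zero μ (f := fun x => f (x, y))
    (hf.comp (contDiff_id.prodMk contDiff_const)) hcs v
  simpa only [hslice] using h0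

end Slices

section Hardy

variable {d : ℕ} {F : Type*} [NormedAddCommGroup F]

/-- The `i`-th component of the vector field `⟨x⟩^{2δ-2} |u|² x`. -/
noncomputable def hardyField (δ : ℝ) (u : EuclideanSpace ℝ (Fin d) × F → ℂ) (i : Fin d)
    (p : EuclideanSpace ℝ (Fin d) × F) : ℝ :=
  p.1 i * ((1 + ‖p.1‖ ^ 2) ^ (δ - 1) * ‖u p‖ ^ 2)

lemma hasCompactSupport_hardyField (δ : ℝ) {u : EuclideanSpace ℝ (Fin d) × F → ℂ}
    (hs : HasCompactSupport u) (i : Fin d) : HasCompactSupport (hardyField δ u i) :=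
  hs.mono fun p hp hup => hp (by simp [hardyField, hup])

variable [NormedSpace ℝ F]

lemma one_add_norm_fst_sq_rpow_contDiff (s : ℝ) :
    ContDiff ℝ 1 fun p : EuclideanSpace ℝ (Fin d) × F => (1 + ‖p.1‖ ^ 2) ^ s :=
  (contDiff_const.add (contDiff_fst.norm_sq ℝ)).rpow_const_of_ne fun p => by positivity

lemma contDiff_hardyField (δ : ℝ) {u : EuclideanSpace ℝ (Fin d) × F → ℂ}
    (hu : ContDiff ℝ 1 u) (i : Fin d) : ContDiff ℝ 1 (hardyField δ u i) := by
  have h1 : ContDiff ℝ 1 fun p : EuclideanSpace ℝ (Fin d) × F => p.1 i :=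
    (EuclideanSpace.proj (𝕜 := ℝ) i).contDiff.comp contDiff_fst
  exact h1.mul ((one_add_norm_fst_sq_rpow_contDiff _).mul (hu.norm_sq ℝ))

lemma fderiv_hardyField_apply (δ : ℝ) {u : EuclideanSpace ℝ (Fin d) × F → ℂ}
    (hu : ContDiff ℝ 1 u) (i : Fin d) (p : EuclideanSpace ℝ (Fin d) × F) :
    fderiv ℝ (hardyField δ u i) p (EuclideanSpace.single i 1, 0) =
      (1 + ‖p.1‖ ^ 2) ^ (δ - 1) * ‖u p‖ ^ 2
      + 2 * (δ - 1) * (1 + ‖p.1‖ ^ 2) ^ (δ - 2) * (p.1 i) ^ 2 * ‖u p‖ ^ 2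
      + 2 * (1 + ‖p.1‖ ^ 2) ^ (δ - 1) * (p.1 i *
        inner ℝ (u p) (fderiv ℝ u p (EuclideanSpace.single i 1, 0))) := by
  have h1 : HasFDerivAt (fun p : EuclideanSpace ℝ (Fin d) × F => p.1 i)
      ((EuclideanSpace.proj (𝕜 := ℝ) i).comp
        (ContinuousLinearMap.fst ℝ (EuclideanSpace ℝ (Fin d)) F)) p :=
    ((EuclideanSpace.proj (𝕜 := ℝ) i).comp
        (ContinuousLinearMap.fst ℝ (EuclideanSpace ℝ (Fin d)) F)).hasFDerivAt
  have h2 := ((hasFDerivAt_fst (𝕜 := ℝ) (p := p)).norm_sq.const_add 1).rpow_const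
    (p := δ - 1) (Or.inl (by positivity))
  have h3 := (hu.differentiable one_ne_zero p).hasFDerivAt.norm_sq
  have h := h1.mul (h2.mul h3)
  have hδ : δ - 1 - 1 = δ - 2 := by ring
  have hfd := h.fderiv
  rw [show (fun p : EuclideanSpace ℝ (Fin d) × F => p.1 i) *
    ((fun p => (1 + ‖p.1‖ ^ 2) ^ (δ - 1)) * fun p => ‖u p‖ ^ 2) = hardyField δ u i from rfl] at hfd
  rw [hfd]
  simp [EuclideanSpace.inner_single_right, hδ]
  ring

/-- The divergence of `⟨x⟩^{2δ-2} |u|² x` controls the Hardy weight from below. -/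
lemma hardyField_div_lower_bound (hd : 1 ≤ d) {δ c : ℝ} (hc : 0 < c) (hc1 : c ≤ 1)
    (hcδ : c ≤ 2 * δ - 1) {u : EuclideanSpace ℝ (Fin d) × F → ℂ} (hu : ContDiff ℝ 1 u)
    (p : EuclideanSpace ℝ (Fin d) × F) :
    c / 2 * ((1 + ‖p.1‖ ^ 2) ^ (δ - 1) * ‖u p‖ ^ 2)
      ≤ (∑ i, fderiv ℝ (hardyField δ u i) p (EuclideanSpace.single i 1, 0))
        + 2 / c * ((1 + ‖p.1‖ ^ 2) ^ δ *
          ∑ i : Fin d, ‖fderiv ℝ u p (EuclideanSpace.single i 1, 0)‖ ^ 2) := by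
  simp only [fderiv_hardyField_apply δ hu]
  have hρ : 0 < 1 + ‖p.1‖ ^ 2 := by positivity
  have hA : (1 + ‖p.1‖ ^ 2) ^ (δ - 1) = (1 + ‖p.1‖ ^ 2) * (1 + ‖p.1‖ ^ 2) ^ (δ - 2) := by
    rw [show δ - 1 = 1 + (δ - 2) by ring, Real.rpow_add hρ, Real.rpow_one]
  have hW : (1 + ‖p.1‖ ^ 2) ^ δ = (1 + ‖p.1‖ ^ 2) ^ 2 * (1 + ‖p.1‖ ^ 2) ^ (δ - 2) := by
    rw [← Real.rpow_two (1 + ‖p.1‖ ^ 2), ← Real.rpow_add hρ, add_sub_cancel]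
  have hB : 0 < (1 + ‖p.1‖ ^ 2) ^ (δ - 2) := Real.rpow_pos_of_pos hρ _
  have hX : ∑ i, (p.1 i) ^ 2 = ‖p.1‖ ^ 2 := (EuclideanSpace.real_norm_sq_eq p.1).symm
  rw [hA, hW]
  set B := (1 + ‖p.1‖ ^ 2) ^ (δ - 2)
  set X := ‖p.1‖ ^ 2
  set U := ‖u p‖
  have hX0 : 0 ≤ X := by positivity
  have hterm (i : Fin d) :
      (1 + X) * B * U ^ 2 + (2 * (δ - 1) - c / 2) * B * U ^ 2 * (p.1 i) ^ 2
        ≤ ((1 + X) * B * U ^ 2 + 2 * (δ - 1) * B * (p.1 i) ^ 2 * U ^ 2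
          + 2 * ((1 + X) * B) * (p.1 i *
            inner ℝ (u p) (fderiv ℝ u p (EuclideanSpace.single i 1, 0))))
          + 2 / c * ((1 + X) ^ 2 * B) *
            ‖fderiv ℝ u p (EuclideanSpace.single i 1, 0)‖ ^ 2 := by
    set w := fderiv ℝ u p (EuclideanSpace.single i 1, 0)
    have hcs : |p.1 i * inner ℝ (u p) w| ≤ |p.1 i| * (U * ‖w‖) := by
      rw [abs_mul]
      gcongr
      exact abs_real_inner_le_norm _ _
    have hcs' := (abs_le.mp hcs).1
    have hsq : 0 ≤ c / 2 * (|p.1 i| * U - 2 / c * ((1 + X) * ‖w‖)) ^ 2 := by positivity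
    have hexp : c / 2 * (|p.1 i| * U - 2 / c * ((1 + X) * ‖w‖)) ^ 2
        = c / 2 * (p.1 i) ^ 2 * U ^ 2 - 2 * (1 + X) * (|p.1 i| * (U * ‖w‖))
          + 2 / c * (1 + X) ^ 2 * ‖w‖ ^ 2 := by
      rw [← sq_abs (p.1 i)]
      field_simp
      ring
    rw [hexp] at hsq
    have hk : 0 ≤ 2 * (1 + X) * (p.1 i * inner ℝ (u p) w + |p.1 i| * (U * ‖w‖)) := by
      have := neg_le_iff_add_nonneg.mp hcs'
      positivity
    have := mul_nonneg hB.le (add_nonneg hsq hk)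
    linarith
  have hsum := Finset.sum_le_sum fun i (_ : i ∈ Finset.univ) => hterm i
  rw [Finset.sum_add_distrib, Finset.sum_add_distrib, ← Finset.mul_sum, ← Finset.mul_sum,
    ← Finset.mul_sum, hX] at hsum
  simp only [Finset.sum_const, Finset.card_univ, Fintype.card_fin, nsmul_eq_mul] at hsum
  have hd' : (1 : ℝ) ≤ d := by exact_mod_cast hd
  have hBU : 0 ≤ B * U ^ 2 := by positivity
  have hcoef : c / 2 * (1 + X) ≤ d * (1 + X) + (2 * (δ - 1) - c / 2) * X := by
    nlinarith [mul_nonneg (sub_nonneg.2 hd') hX0, mul_nonneg (sub_nonneg.2 hcδ) hX0]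
  have := mul_le_mul_of_nonneg_right hcoef hBU
  linear_combination this + hsum

end Hardy

theorem stmt_10 (d n : ℕ) (hd : 1 ≤ d) (hn : 1 ≤ n)
    (ω : Set (EuclideanSpace ℝ (Fin n))) (hω_open : IsOpen ω)
    (hω_bdd : Bornology.IsBounded ω) (hω_ne : ω.Nonempty)
    (δ σ : ℝ) (hδ : 1 / 2 < δ) (hσ : σ < δ - 1) :
    ∃ C : ℝ, 0 ≤ C ∧
      ∀ u : EuclideanSpace ℝ (Fin d) × EuclideanSpace ℝ (Fin n) → ℂ,
        ContDiff ℝ (⊤ : ℕ∞) u → HasCompactSupport u →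
        Real.sqrt (∫ p in (Set.univ ×ˢ ω),
            (1 + ‖p.1‖ ^ 2) ^ σ * ‖u p‖ ^ 2)
          ≤ C * Real.sqrt (∫ p in (Set.univ ×ˢ ω),
              (1 + ‖p.1‖ ^ 2) ^ δ *
                ((∑ i : Fin d,
                    ‖fderiv ℝ u p (EuclideanSpace.single i 1, 0)‖ ^ 2) +
                  ∑ j : Fin n,
                    ‖fderiv ℝ u p (0, EuclideanSpace.single j 1)‖ ^ 2)) := by
  set c : ℝ := min 1 (2 * δ - 1)
  have hc : 0 < c := lt_min one_pos (by linarith)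
  refine ⟨2 / c, by positivity, fun u hu hs => ?_⟩
  have hu1 : ContDiff ℝ 1 u := hu.of_le (by exact_mod_cast le_top)
  have hdu (v : EuclideanSpace ℝ (Fin d) × EuclideanSpace ℝ (Fin n)) :
      Continuous fun p => ‖fderiv ℝ u p v‖ ^ 2 :=
    (((hu1.continuous_fderiv one_ne_zero).clm_apply continuous_const).norm).pow 2
  have hIσ : Integrable fun p : EuclideanSpace ℝ (Fin d) × EuclideanSpace ℝ (Fin n) =>
      (1 + ‖p.1‖ ^ 2) ^ σ * ‖u p‖ ^ 2 :=
    ((one_add_norm_fst_sq_rpow_contDiff σ).continuous.mul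
      (hu.continuous.norm.pow 2)).integrable_of_hasCompactSupport
      (hs.mono fun p hp hup => hp (by simp [hup]))
  have hIδ : Integrable fun p : EuclideanSpace ℝ (Fin d) × EuclideanSpace ℝ (Fin n) =>
      (1 + ‖p.1‖ ^ 2) ^ δ *
        ((∑ i : Fin d, ‖fderiv ℝ u p (EuclideanSpace.single i 1, 0)‖ ^ 2) +
          ∑ j : Fin n, ‖fderiv ℝ u p (0, EuclideanSpace.single j 1)‖ ^ 2) :=
    ((one_add_norm_fst_sq_rpow_contDiff δ).continuous.mul
      ((continuous_finsetSum _ fun i _ => hdu _).add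
        (continuous_finsetSum _ fun j _ => hdu _))).integrable_of_hasCompactSupport
      ((hs.fderiv ℝ).mono fun p hp hup => hp (by simp [hup]))
  have hIG (i : Fin d) :
      Integrable fun p : EuclideanSpace ℝ (Fin d) × EuclideanSpace ℝ (Fin n) =>
        fderiv ℝ (hardyField δ u i) p (EuclideanSpace.single i 1, 0) :=
    integrable_fderiv_apply (contDiff_hardyField δ hu1 i) (hasCompactSupport_hardyField δ hs i) _
  have hpt (p : EuclideanSpace ℝ (Fin d) × EuclideanSpace ℝ (Fin n)) :
      c / 2 * ((1 + ‖p.1‖ ^ 2) ^ σ * ‖u p‖ ^ 2)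
        ≤ (∑ i, fderiv ℝ (hardyField δ u i) p (EuclideanSpace.single i 1, 0))
          + 2 / c * ((1 + ‖p.1‖ ^ 2) ^ δ *
            ((∑ i : Fin d, ‖fderiv ℝ u p (EuclideanSpace.single i 1, 0)‖ ^ 2) +
              ∑ j : Fin n, ‖fderiv ℝ u p (0, EuclideanSpace.single j 1)‖ ^ 2)) := by
    refine le_trans ?_ ((hardyField_div_lower_bound hd hc (min_le_left _ _)
      (min_le_right _ _) hu1 p).trans ?_)
    · gcongr
      linarith [sq_nonneg ‖p.1‖]
    · gcongr
      exact le_add_of_nonneg_right (by positivity)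
  have hmono := integral_mono (μ := volume.restrict (Set.univ ×ˢ ω))
    (hIσ.restrict.const_mul (c / 2))
    ((integrable_finsetSum _ fun i _ => (hIG i).restrict).add (hIδ.restrict.const_mul (2 / c)))
    hpt
  have hzero : ∑ i, ∫ p in Set.univ ×ˢ ω,
      fderiv ℝ (hardyField δ u i) p (EuclideanSpace.single i 1, 0) = 0 :=
    Finset.sum_eq_zero fun i _ => setIntegral_univ_prod_fderiv_apply_eq_zero volume volume
      (contDiff_hardyField δ hu1 i) (hasCompactSupport_hardyField δ hs i) ω _
  simp only [Pi.add_apply] at hmono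
  rw [integral_add (integrable_finsetSum _ fun i _ => (hIG i).restrict)
      (hIδ.restrict.const_mul (2 / c)),
    integral_finsetSum _ fun i _ => (hIG i).restrict, hzero, zero_add,
    integral_const_mul, integral_const_mul] at hmono
  rw [← Real.sqrt_sq (show 0 ≤ 2 / c by positivity), ← Real.sqrt_mul (sq_nonneg _)]
  refine Real.sqrt_le_sqrt ?_
  have hmul := mul_le_mul_of_nonneg_left hmono (show 0 ≤ 2 / c by positivity)
  rw [← mul_assoc, ← mul_assoc, show 2 / c * (c / 2) = 1 by field_simp, one_mul, ← sq] at hmul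
  exact hmul
end

section
/- (Weighted Hardy inequality on ℝ^d, used in the proof of Lemma 3.3; extension of a cited lemma to d ≥ 1 and δ > 1/2) Let d ≥ 1, δ > 1/2 and σ < δ − 1. Then there exists C ≥ 0 such that for every smooth compactly supported function u : ℝ^d → ℂ one has (∫_{ℝ^d} ⟨x⟩^{2σ} |u(x)|² dx)^{1/2} ≤ C · (∫_{ℝ^d} ⟨x⟩^{2δ} |∇u(x)|² dx)^{1/2}. -/
open MeasureTheory

section Divergence

variable {E : Type*} [NormedAddCommGroup E] [NormedSpace ℝ E]
  [MeasurableSpace E] [BorelSpace E] {μ : Measure E}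

theorem integrable_fderiv_apply_of_hasCompactSupport [IsFiniteMeasureOnCompacts μ]
    {f : E → ℝ} (hf : ContDiff ℝ 1 f) (hc : HasCompactSupport f) (v : E) :
    Integrable (fun x => fderiv ℝ f x v) μ :=
  ((hf.continuous_fderiv one_ne_zero).clm_apply continuous_const).integrable_of_hasCompactSupport
    (hc.fderiv_apply ℝ v)

theorem integral_fderiv_apply_eq_zero_of_hasCompactSupport [FiniteDimensional ℝ E]
    [μ.IsAddHaarMeasure] {f : E → ℝ} (hf : ContDiff ℝ 1 f)
    (hc : HasCompactSupport f) (v : E) : ∫ x, fderiv ℝ f x v ∂μ = 0 := by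
  have h := integral_mul_fderiv_eq_neg_fderiv_mul_of_integrable (𝕜 := ℝ) (μ := μ)
    (f := fun _ => (1 : ℝ)) (g := f) (v := v) (by simp)
    (by simpa using integrable_fderiv_apply_of_hasCompactSupport hf hc v)
    (by simpa using hf.continuous.integrable_of_hasCompactSupport hc)
    (fun x _ => differentiableAt_const _) (fun x _ => hf.differentiable one_ne_zero x)
  simpa using h

end Divergence

section WeightedHardy

variable {d : ℕ}

theorem contDiff_one_add_norm_sq_rpow {E : Type*} [NormedAddCommGroup E] [InnerProductSpace ℝ E]
    {n : WithTop ℕ∞} (s : ℝ) : ContDiff ℝ n fun x : E => (1 + ‖x‖ ^ 2) ^ s :=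
  (contDiff_const.add (contDiff_norm_sq ℝ)).rpow_const_of_ne fun x => by positivity

theorem contDiff_weighted_coord_mul_norm_sq {u : EuclideanSpace ℝ (Fin d) → ℂ} {n : WithTop ℕ∞}
    (hu : ContDiff ℝ n u) (s : ℝ) (i : Fin d) :
    ContDiff ℝ n fun x => (1 + ‖x‖ ^ 2) ^ s * x i * ‖u x‖ ^ 2 :=
  ((contDiff_one_add_norm_sq_rpow s).mul (EuclideanSpace.proj (𝕜 := ℝ) i).contDiff).mul
    (hu.norm_sq ℝ)

theorem fderiv_weighted_coord_mul_norm_sq {u : EuclideanSpace ℝ (Fin d) → ℂ}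
    {x : EuclideanSpace ℝ (Fin d)} (hu : DifferentiableAt ℝ u x) (s : ℝ) (i : Fin d) :
    fderiv ℝ (fun x => (1 + ‖x‖ ^ 2) ^ s * x i * ‖u x‖ ^ 2) x (EuclideanSpace.single i 1) =
      (1 + ‖x‖ ^ 2) ^ s * ((1 + 2 * s * (x i ^ 2 / (1 + ‖x‖ ^ 2))) * ‖u x‖ ^ 2 +
        2 * x i * inner ℝ (u x) (fderiv ℝ u x (EuclideanSpace.single i 1))) := by
  have hpos : 0 < 1 + ‖x‖ ^ 2 := by positivity
  have h₁ := ((hasFDerivAt_id x).norm_sq.const_add 1).rpow_const (p := s) (Or.inl hpos.ne')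
  have h₂ : HasFDerivAt (fun y : EuclideanSpace ℝ (Fin d) => y i)
      (EuclideanSpace.proj (𝕜 := ℝ) i) x := (EuclideanSpace.proj (𝕜 := ℝ) i).hasFDerivAt
  have h := (h₁.mul h₂).mul hu.hasFDerivAt.norm_sq
  have h' := congrArg (fun L => L (EuclideanSpace.single i (1 : ℝ))) h.fderiv
  refine Eq.trans h' ?_
  simp [Real.rpow_sub_one hpos.ne', EuclideanSpace.inner_single_right]
  field_simp
  ring

theorem weighted_hardy_pointwise {u : EuclideanSpace ℝ (Fin d) → ℂ}
    {x : EuclideanSpace ℝ (Fin d)} (hu : DifferentiableAt ℝ u x) (hd : 1 ≤ d) {s c : ℝ}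
    (hc : 0 < c) (hc₁ : c ≤ 1) (hc₂ : c ≤ 1 + 2 * s) :
    c / 2 * ((1 + ‖x‖ ^ 2) ^ s * ‖u x‖ ^ 2) - 2 / c * ((1 + ‖x‖ ^ 2) ^ (s + 1) *
        ∑ i : Fin d, ‖fderiv ℝ u x (EuclideanSpace.single i 1)‖ ^ 2) ≤
      ∑ i : Fin d, fderiv ℝ (fun x => (1 + ‖x‖ ^ 2) ^ s * x i * ‖u x‖ ^ 2) x
        (EuclideanSpace.single i 1) := by
  have hpos : 0 < 1 + ‖x‖ ^ 2 := by positivity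
  set A := 1 + ‖x‖ ^ 2 with hA
  set t := ‖x‖ ^ 2 / A with ht
  have ht0 : 0 ≤ t := by positivity
  have ht1 : t ≤ 1 := (div_le_one hpos).2 (by linarith)
  have hsum : ∑ i : Fin d, x i ^ 2 / A = t := by
    rw [← Finset.sum_div, ht, EuclideanSpace.real_norm_sq_eq]
  have hd' : (1 : ℝ) ≤ d := by exact_mod_cast hd
  have hterm : ∀ i : Fin d,
      A ^ s * ((1 + (2 * s - c / 2) * (x i ^ 2 / A)) * ‖u x‖ ^ 2 -
        2 / c * A * ‖fderiv ℝ u x (EuclideanSpace.single i 1)‖ ^ 2) ≤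
      fderiv ℝ (fun x => (1 + ‖x‖ ^ 2) ^ s * x i * ‖u x‖ ^ 2) x
        (EuclideanSpace.single i 1) := by
    intro i
    rw [fderiv_weighted_coord_mul_norm_sq hu, ← hA]
    refine mul_le_mul_of_nonneg_left ?_ (by positivity)
    set p := fderiv ℝ u x (EuclideanSpace.single i 1)
    have h₁ : |x i * inner ℝ (u x) p| ≤ |x i| * (‖u x‖ * ‖p‖) := by
      rw [abs_mul]
      exact mul_le_mul_of_nonneg_left (abs_real_inner_le_norm _ _) (abs_nonneg _)
    have h₂ : 0 ≤ (c / 2 * |x i| * ‖u x‖ - A * ‖p‖) ^ 2 * (2 / (c * A)) := by positivity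
    have h₃ : (c / 2 * |x i| * ‖u x‖ - A * ‖p‖) ^ 2 * (2 / (c * A)) =
        c / 2 * (x i ^ 2 / A) * ‖u x‖ ^ 2 - 2 * (|x i| * (‖u x‖ * ‖p‖)) + 2 / c * A * ‖p‖ ^ 2 := by
      rw [← sq_abs (x i)]
      field_simp
      ring
    linarith [neg_abs_le (x i * inner ℝ (u x) p)]
  refine le_trans ?_ (Finset.sum_le_sum fun i _ => hterm i)
  rw [← Finset.mul_sum, Finset.sum_sub_distrib, ← Finset.mul_sum, ← Finset.sum_mul,
    Finset.sum_add_distrib, ← Finset.mul_sum, hsum, Real.rpow_add_one hpos.ne']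
  have hcoef : c / 2 ≤ d + (2 * s - c / 2) * t := by nlinarith
  have := mul_le_mul_of_nonneg_left hcoef (by positivity : 0 ≤ A ^ s * ‖u x‖ ^ 2)
  simp only [Finset.sum_const, Finset.card_univ, Fintype.card_fin, nsmul_eq_mul, mul_one]
  linarith

theorem integrable_one_add_norm_sq_rpow_mul_norm_sq {u : EuclideanSpace ℝ (Fin d) → ℂ}
    (hu : Continuous u) (hcs : HasCompactSupport u) (s : ℝ) :
    Integrable fun x => (1 + ‖x‖ ^ 2) ^ s * ‖u x‖ ^ 2 := by
  have hsq : HasCompactSupport fun x => ‖u x‖ ^ 2 :=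
    hcs.comp_left (g := fun z : ℂ => ‖z‖ ^ 2) (by simp)
  exact ((contDiff_one_add_norm_sq_rpow (n := 0) s).continuous.mul
    (hu.norm.pow 2)).integrable_of_hasCompactSupport hsq.mul_left

theorem weighted_hardy_integral {u : EuclideanSpace ℝ (Fin d) → ℂ} (hu : ContDiff ℝ 1 u)
    (hcs : HasCompactSupport u) (hd : 1 ≤ d) {s c : ℝ} (hc : 0 < c) (hc₁ : c ≤ 1)
    (hc₂ : c ≤ 1 + 2 * s) :
    ∫ x, (1 + ‖x‖ ^ 2) ^ s * ‖u x‖ ^ 2 ≤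
      (2 / c) ^ 2 * ∫ x, (1 + ‖x‖ ^ 2) ^ (s + 1) *
        ∑ i : Fin d, ‖fderiv ℝ u x (EuclideanSpace.single i 1)‖ ^ 2 := by
  have hsq : HasCompactSupport fun x => ‖u x‖ ^ 2 :=
    hcs.comp_left (g := fun z : ℂ => ‖z‖ ^ 2) (by simp)
  have hI₁ := integrable_one_add_norm_sq_rpow_mul_norm_sq hu.continuous hcs s
  have hI₂ : Integrable fun x : EuclideanSpace ℝ (Fin d) => (1 + ‖x‖ ^ 2) ^ (s + 1) *
      ∑ i : Fin d, ‖fderiv ℝ u x (EuclideanSpace.single i 1)‖ ^ 2 := by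
    refine Continuous.integrable_of_hasCompactSupport
      ((contDiff_one_add_norm_sq_rpow (n := 0) (s + 1)).continuous.mul
        (continuous_finsetSum _ fun i _ => (((hu.continuous_fderiv one_ne_zero).clm_apply
          continuous_const).norm.pow 2))) (HasCompactSupport.mul_left ?_)
    exact (hcs.fderiv ℝ).comp_left
      (g := fun L : EuclideanSpace ℝ (Fin d) →L[ℝ] ℂ =>
        ∑ i : Fin d, ‖L (EuclideanSpace.single i 1)‖ ^ 2) (by simp)
  have hg : ∀ i : Fin d, ContDiff ℝ 1
      fun x : EuclideanSpace ℝ (Fin d) => (1 + ‖x‖ ^ 2) ^ s * x i * ‖u x‖ ^ 2 :=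
    fun i => contDiff_weighted_coord_mul_norm_sq hu s i
  have hD : ∀ i : Fin d, Integrable fun x => fderiv ℝ
      (fun x : EuclideanSpace ℝ (Fin d) => (1 + ‖x‖ ^ 2) ^ s * x i * ‖u x‖ ^ 2) x
        (EuclideanSpace.single i 1) := fun i =>
    integrable_fderiv_apply_of_hasCompactSupport (hg i) hsq.mul_left _
  have hzero : ∫ x, ∑ i : Fin d, fderiv ℝ
      (fun x : EuclideanSpace ℝ (Fin d) => (1 + ‖x‖ ^ 2) ^ s * x i * ‖u x‖ ^ 2) x
        (EuclideanSpace.single i 1) = 0 := by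
    rw [integral_finsetSum _ fun i _ => hD i]
    exact Finset.sum_eq_zero fun i _ =>
      integral_fderiv_apply_eq_zero_of_hasCompactSupport (hg i) hsq.mul_left _
  have hle := integral_mono ((hI₁.const_mul (c / 2)).sub (hI₂.const_mul (2 / c)))
    (integrable_finsetSum Finset.univ fun i _ => hD i)
    fun x => weighted_hardy_pointwise (hu.differentiable one_ne_zero x) hd hc hc₁ hc₂
  rw [hzero, integral_sub' (hI₁.const_mul _) (hI₂.const_mul _), integral_const_mul,
    integral_const_mul] at hle
  have := mul_le_mul_of_nonneg_left (sub_nonpos.1 hle) (by positivity : 0 ≤ 2 / c)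
  rw [← mul_assoc, ← mul_assoc, ← sq] at this
  rwa [show 2 / c * (c / 2) = 1 by field_simp, one_mul] at this

theorem integral_one_add_norm_sq_rpow_mul_norm_sq_mono {u : EuclideanSpace ℝ (Fin d) → ℂ}
    (hu : Continuous u) (hcs : HasCompactSupport u) {s t : ℝ} (hst : s ≤ t) :
    ∫ x, (1 + ‖x‖ ^ 2) ^ s * ‖u x‖ ^ 2 ≤ ∫ x, (1 + ‖x‖ ^ 2) ^ t * ‖u x‖ ^ 2 := by
  refine integral_mono (integrable_one_add_norm_sq_rpow_mul_norm_sq hu hcs s)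
    (integrable_one_add_norm_sq_rpow_mul_norm_sq hu hcs t) fun x => ?_
  exact mul_le_mul_of_nonneg_right
    (Real.rpow_le_rpow_of_exponent_le (by linarith [sq_nonneg ‖x‖]) hst) (sq_nonneg _)

end WeightedHardy

theorem stmt_11 (d : ℕ) (hd : 1 ≤ d) (δ σ : ℝ) (hδ : 1 / 2 < δ) (hσ : σ < δ - 1) :
    ∃ C : ℝ, 0 ≤ C ∧
      ∀ u : EuclideanSpace ℝ (Fin d) → ℂ,
        ContDiff ℝ (⊤ : ℕ∞) u → HasCompactSupport u →
        Real.sqrt (∫ x, (1 + ‖x‖ ^ 2) ^ σ * ‖u x‖ ^ 2)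
          ≤ C * Real.sqrt (∫ x, (1 + ‖x‖ ^ 2) ^ δ *
              ∑ i : Fin d, ‖fderiv ℝ u x (EuclideanSpace.single i 1)‖ ^ 2) := by
  obtain ⟨c, hc, hc₁, hc₂⟩ : ∃ c : ℝ, 0 < c ∧ c ≤ 1 ∧ c ≤ 1 + 2 * (δ - 1) :=
    ⟨min 1 (1 + 2 * (δ - 1)), lt_min one_pos (by linarith), min_le_left _ _, min_le_right _ _⟩
  refine ⟨2 / c, by positivity, fun u hu hcs => ?_⟩
  have h := (integral_one_add_norm_sq_rpow_mul_norm_sq_mono hu.continuous hcs hσ.le).trans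
    (weighted_hardy_integral (hu.of_le (by exact_mod_cast le_top)) hcs hd hc hc₁ hc₂)
  rw [sub_add_cancel] at h
  refine (Real.sqrt_le_sqrt h).trans_eq ?_
  rw [Real.sqrt_mul (sq_nonneg _), Real.sqrt_sq (by positivity)]
end

section
/- (Proposition 5.1 in the one-dimensional setting: derivative of the first transverse eigenvalue at 0) Let ℓ > 0, ν = π/ℓ and Υ = 2/ℓ. Let α₀ > 0 and let θ : [0, α₀) → ℂ be continuous with θ(0) = 0 and such that for every α ∈ (0, α₀): (α − θ(α))² e^{2iℓθ(α)} = (α + θ(α))², Re θ(α) ∈ (0, ν) and Im θ(α) < 0. Then θ(α)²/α → −iΥ as α → 0⁺. -/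
/-- For `c ≠ 0`, `z (e^{cz} + 1) / (e^{cz} - 1)` tends to `2 / c` as `z → 0`. -/
theorem tendsto_mul_exp_add_one_div_exp_sub_one {c : ℂ} (hc : c ≠ 0) :
    Filter.Tendsto (fun z : ℂ => z * (Complex.exp (c * z) + 1) / (Complex.exp (c * z) - 1))
      (nhdsWithin 0 {0}ᶜ) (nhds (2 / c)) := by
  have hd : HasDerivAt (fun z : ℂ => Complex.exp (c * z)) c 0 := by
    simpa using ((hasDerivAt_id (0 : ℂ)).const_mul c).cexp
  have hslope := (hasDerivAt_iff_tendsto_slope.mp hd).inv₀ hc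
  have hadd : Filter.Tendsto (fun z : ℂ => Complex.exp (c * z) + 1)
      (nhdsWithin 0 {0}ᶜ) (nhds 2) := by
    have h := hd.continuousAt.tendsto.add_const 1
    simp only [mul_zero, Complex.exp_zero] at h
    norm_num at h
    exact h.mono_left nhdsWithin_le_nhds
  refine (hadd.mul hslope).congr fun z => ?_
  simp only [slope_def_field, mul_zero, Complex.exp_zero, sub_zero, inv_div]
  ring


theorem stmt_16 (ℓ : ℝ) (hℓ : 0 < ℓ) (ν Υ : ℝ) (hν : ν = Real.pi / ℓ)
    (hΥ : Υ = 2 / ℓ) (α₀ : ℝ) (hα₀ : 0 < α₀) (θ : ℝ → ℂ)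
    (hcont : ContinuousOn θ (Set.Ico 0 α₀)) (h0 : θ 0 = 0)
    (heq : ∀ α ∈ Set.Ioo (0 : ℝ) α₀,
      ((α : ℂ) - θ α) ^ 2 * Complex.exp (2 * Complex.I * (ℓ : ℂ) * θ α)
        = ((α : ℂ) + θ α) ^ 2)
    (hre : ∀ α ∈ Set.Ioo (0 : ℝ) α₀, (θ α).re ∈ Set.Ioo 0 ν)
    (him : ∀ α ∈ Set.Ioo (0 : ℝ) α₀, (θ α).im < 0) :
    Filter.Tendsto (fun α : ℝ => (θ α) ^ 2 / (α : ℂ))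
      (nhdsWithin 0 (Set.Ioi 0)) (nhds (-Complex.I * (Υ : ℂ))) := by
  have hc : Complex.I * (ℓ : ℂ) ≠ 0 :=
    mul_ne_zero Complex.I_ne_zero (Complex.ofReal_ne_zero.mpr hℓ.ne')
  have hlim : -Complex.I * (Υ : ℂ) = 2 / (Complex.I * ℓ) := by
    have hℓ' : (ℓ : ℂ) ≠ 0 := Complex.ofReal_ne_zero.mpr hℓ.ne'
    rw [hΥ, eq_div_iff hc]
    push_cast
    field_simp
    linear_combination (-1 : ℂ) * Complex.I_sq
  have hIoo : ∀ᶠ α in nhdsWithin (0 : ℝ) (Set.Ioi 0), α ∈ Set.Ioo 0 α₀ :=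
    Ioo_mem_nhdsGT hα₀
  have hne : ∀ α ∈ Set.Ioo (0 : ℝ) α₀, θ α ≠ 0 := fun α hα h => by
    simpa [h] using him α hα
  have hθ : Filter.Tendsto θ (nhdsWithin 0 (Set.Ioi 0)) (nhdsWithin 0 {0}ᶜ) := by
    refine tendsto_nhdsWithin_iff.mpr ⟨?_, hIoo.mono hne⟩
    have h := ((hcont 0 ⟨le_rfl, hα₀⟩).mono Set.Ioo_subset_Ico_self).tendsto
    rwa [h0, nhdsWithin_Ioo_eq_nhdsGT hα₀] at h
  have hF := (tendsto_mul_exp_add_one_div_exp_sub_one hc).comp hθ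
  have hα : Filter.Tendsto (fun α : ℝ => (α : ℂ)) (nhdsWithin 0 (Set.Ioi 0)) (nhds 0) := by
    have h := Complex.continuous_ofReal.tendsto 0
    rw [Complex.ofReal_zero] at h
    exact h.mono_left nhdsWithin_le_nhds
  have hlim0 : 2 / (Complex.I * (ℓ : ℂ)) ≠ 0 := div_ne_zero two_ne_zero hc
  have hFα := (hF.sub hα).eventually_ne (by rwa [sub_zero] : 2 / (Complex.I * (ℓ : ℂ)) - 0 ≠ 0)
  rw [hlim]
  refine hF.congr' ?_
  filter_upwards [hIoo, hF.eventually_ne hlim0, hFα] with α hmem hF0 hFne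
  have hα0 : (α : ℂ) ≠ 0 := Complex.ofReal_ne_zero.mpr hmem.1.ne'
  have hz := hne α hmem
  have h := heq α hmem
  have hexp : Complex.exp (2 * Complex.I * ℓ * θ α) = Complex.exp (Complex.I * ℓ * θ α) ^ 2 := by
    rw [← Complex.exp_nat_mul]
    congr 1
    push_cast
    ring
  rw [hexp] at h
  simp only [Function.comp_apply] at hF0 hFne ⊢
  generalize Complex.exp (Complex.I * ℓ * θ α) = E at *
  have hE : E - 1 ≠ 0 := fun h => hF0 (by rw [h, div_zero])
  rw [← mul_pow, sq_eq_sq_iff_eq_or_eq_neg] at h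
  rcases h with h | h
  · refine absurd ?_ hFne
    rw [sub_eq_zero, div_eq_iff hE]
    linear_combination -h
  · rw [div_eq_div_iff hE hα0]
    linear_combination θ α * h
end
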